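/- arXiv:1611.08039 — 3 statements merged into one kernel-verified Lean document; each statement's English description precedes it below -/
import Mathlib

section
/- Let P be a wedge-simple d-dimensional polyhedron and let F be any d'-dimensional face of P with 1 < d' < d. Then F is also wedge-simple. -/
open scoped BigOperators

/-- Data defining a polyhedron `{z ∈ ℝ^d : A z ≥ b}` with rational data.
Under the `IsProper` assumption below it is full-dimensional with an
irredundant description, hence `d`-dimensional with exactly `f` facets. -/
structure PolyData (d f : ℕ) where
  A : Matrix (Fin f) (Fin d) ℚ
  b : Fin f → ℚ

namespace PolyData

variable {d f : ℕ}

/-- The `i`-th row of `A` (outer normal of the `i`-th facet), as a real vector. -/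
def row (P : PolyData d f) (i : Fin f) : Fin d → ℝ := fun j => (P.A i j : ℝ)

/-- The `i`-th right-hand side, as a real number. -/
def rhs (P : PolyData d f) (i : Fin f) : ℝ := (P.b i : ℝ)

/-- Value of the `i`-th linear form at `z`. -/
def eval (P : PolyData d f) (i : Fin f) (z : Fin d → ℝ) : ℝ := ∑ j, P.row i j * z j

/-- The feasible set `{z : A z ≥ b}`. -/
def toSet (P : PolyData d f) : Set (Fin d → ℝ) := {z | ∀ i, P.rhs i ≤ P.eval i z}

/-- Indices of the constraints (facets) active (incident) at `z`. -/
def activeAt (P : PolyData d f) (z : Fin d → ℝ) : Set (Fin f) := {i | P.eval i z = P.rhs i}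

/-- The `i`-th facet, as a subset of the polyhedron. -/
def facet (P : PolyData d f) (i : Fin f) : Set (Fin d → ℝ) :=
  {z ∈ P.toSet | P.eval i z = P.rhs i}

/-- The standing assumption: the polyhedron is full-dimensional and the
description is irredundant, i.e. every inequality is facet-defining. -/
def IsProper (P : PolyData d f) : Prop :=
  (∃ z, ∀ i, P.rhs i < P.eval i z) ∧
  ∀ i, ∃ z ∈ P.toSet, P.eval i z = P.rhs i ∧ ∀ i', i' ≠ i → P.rhs i' < P.eval i' z

/-- A vertex: a feasible point whose active outer normals span `ℝ^d`. -/
def IsVertex (P : PolyData d f) (v : Fin d → ℝ) : Prop :=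
  v ∈ P.toSet ∧ Submodule.span ℝ (P.row '' P.activeAt v) = ⊤

/-- A circuit direction of `P`: a nonzero `g` such that `A g` is
support-minimal in `{A x : x ≠ 0}` (taken here up to scaling). -/
def IsCircuit (P : PolyData d f) (g : Fin d → ℝ) : Prop :=
  g ≠ 0 ∧ ∀ x : Fin d → ℝ, x ≠ 0 →
    {i | P.eval i x ≠ 0} ⊆ {i | P.eval i g ≠ 0} →
    {i | P.eval i x ≠ 0} = {i | P.eval i g ≠ 0}

/-- The set of circuits of `P`. -/
def circuits (P : PolyData d f) : Set (Fin d → ℝ) := {g | P.IsCircuit g}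

/-- A (maximal) circuit walk `y 0, …, y k` of length `k`. -/
def IsCircuitWalk (P : PolyData d f) {k : ℕ} (y : Fin (k+1) → Fin d → ℝ) : Prop :=
  (∀ i, y i ∈ P.toSet) ∧
  ∀ i : Fin k, ∃ g ∈ P.circuits, ∃ α : ℝ, 0 < α ∧
    y i.succ = y i.castSucc + α • g ∧
    ∀ β : ℝ, α < β → y i.castSucc + β • g ∉ P.toSet

/-- The circuit distance from `u` to `v`: minimum length of a circuit walk. -/
noncomputable def circuitDistance (P : PolyData d f) (u v : Fin d → ℝ) : ℕ∞ :=
  sInf {n : ℕ∞ | ∃ k : ℕ, n = (k : ℕ∞) ∧ ∃ y : Fin (k+1) → Fin d → ℝ,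
    P.IsCircuitWalk y ∧ y 0 = u ∧ y (Fin.last k) = v}

/-- The circuit diameter: maximum circuit distance between two vertices. -/
noncomputable def circuitDiameter (P : PolyData d f) : ℕ∞ :=
  ⨆ (u : Fin d → ℝ) (v : Fin d → ℝ) (_ : P.IsVertex u) (_ : P.IsVertex v),
    P.circuitDistance u v

/-- `u` and `v` are joined by an edge of `P`. -/
def IsEdge (P : PolyData d f) (u v : Fin d → ℝ) : Prop :=
  P.IsVertex u ∧ P.IsVertex v ∧ u ≠ v ∧
  segment ℝ u v = {z ∈ P.toSet | P.activeAt u ∩ P.activeAt v ⊆ P.activeAt z}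

/-- An edge walk along vertices of `P`. -/
def IsEdgeWalk (P : PolyData d f) {k : ℕ} (y : Fin (k+1) → Fin d → ℝ) : Prop :=
  ∀ i : Fin k, P.IsEdge (y i.castSucc) (y i.succ)

/-- Combinatorial (edge) distance between two vertices. -/
noncomputable def edgeDistance (P : PolyData d f) (u v : Fin d → ℝ) : ℕ∞ :=
  sInf {n : ℕ∞ | ∃ k : ℕ, n = (k : ℕ∞) ∧ ∃ y : Fin (k+1) → Fin d → ℝ,
    P.IsEdgeWalk y ∧ y 0 = u ∧ y (Fin.last k) = v}

/-- Combinatorial (edge) diameter. -/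
noncomputable def edgeDiameter (P : PolyData d f) : ℕ∞ :=
  ⨆ (u : Fin d → ℝ) (v : Fin d → ℝ) (_ : P.IsVertex u) (_ : P.IsVertex v),
    P.edgeDistance u v

end PolyData

/-- `Δ_E(f,d)`: maximum combinatorial diameter of a `d`-dimensional
polyhedron with `f` facets. -/
noncomputable def maxEdgeDiameter (f d : ℕ) : ℕ∞ :=
  ⨆ (P : PolyData d f) (_ : P.IsProper), P.edgeDiameter

/-- `Δ_C(f,d)`: maximum circuit diameter of a `d`-dimensional polyhedron
with `f` facets. -/
noncomputable def maxCircuitDiameter (f d : ℕ) : ℕ∞ :=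
  ⨆ (P : PolyData d f) (_ : P.IsProper), P.circuitDiameter

/-- `Δ_C^u(f,d)`: maximum circuit diameter of an unbounded `d`-dimensional
polyhedron with `f` facets. -/
noncomputable def maxUnboundedCircuitDiameter (f d : ℕ) : ℕ∞ :=
  ⨆ (P : PolyData d f) (_ : P.IsProper ∧ ¬ Bornology.IsBounded P.toSet),
    P.circuitDiameter

namespace PolyData

variable {d f : ℕ}

/-- A walk is simple if each step enters exactly one new facet. -/
def IsSimpleWalk (P : PolyData d f) {k : ℕ} (y : Fin (k+1) → Fin d → ℝ) : Prop :=
  ∀ i : Fin k, (P.activeAt (y i.succ) \ P.activeAt (y i.castSucc)).ncard = 1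

/-- `P` is `C`-simple: all circuit walks of length at most `Δ_E(f,d)` are simple. -/
def IsCSimple (P : PolyData d f) : Prop :=
  ∀ k : ℕ, (k : ℕ∞) ≤ maxEdgeDiameter f d →
    ∀ y : Fin (k+1) → Fin d → ℝ, P.IsCircuitWalk y → P.IsSimpleWalk y

/-- A non-revisiting walk: each step enters a facet containing no earlier
point of the walk. -/
def IsNonRevisiting (P : PolyData d f) {k : ℕ} (y : Fin (k+1) → Fin d → ℝ) : Prop :=
  ∀ i : Fin k, ∃ j : Fin f, j ∈ P.activeAt (y i.succ) ∧
    ∀ i' : Fin (k+1), i' ≤ i.castSucc → j ∉ P.activeAt (y i')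

/-- `P` is a simple polyhedron: every vertex lies on exactly `d` facets. -/
def IsSimplePoly (P : PolyData d f) : Prop :=
  ∀ v, P.IsVertex v → (P.activeAt v).ncard = d

end PolyData

/-- Append a last coordinate: `(z, t) ∈ ℝ^{d+1}`. -/
def snocVec {d : ℕ} (z : Fin d → ℝ) (t : ℝ) : Fin (d+1) → ℝ := Fin.snoc z t

namespace PolyData

variable {d f : ℕ}

/-- `W` is a wedge on `P` over the facet with index `i₀`:
`W = H^≤ ∩ (P × [0,∞))`, where the boundary hyperplane `H = {w : a·w = β}`
of the halfspace `H^≤` contains `P × {0}` on its feasible side, meets the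
interior of `P × [0,∞)`, and meets `P × {0}` exactly in the facet `i₀`. -/
def IsWedgeOver (W : PolyData (d+1) (f+1)) (P : PolyData d f) (i₀ : Fin f) : Prop :=
  ∃ (a : Fin (d+1) → ℝ) (β : ℝ),
    (∀ z ∈ P.toSet, ∑ j, a j * snocVec z 0 j ≤ β) ∧
    (∃ z, (∀ i, P.rhs i < P.eval i z) ∧ ∃ t : ℝ, 0 < t ∧ ∑ j, a j * snocVec z t j = β) ∧
    (∀ z ∈ P.toSet, (∑ j, a j * snocVec z 0 j = β ↔ z ∈ P.facet i₀)) ∧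
    W.toSet = {w | ∑ j, a j * w j ≤ β} ∩
      {w | ∃ z ∈ P.toSet, ∃ t : ℝ, 0 ≤ t ∧ w = snocVec z t}

/-- `P` is wedge-simple: it is `C`-simple and over every facet there is a
`C`-simple wedge. -/
def IsWedgeSimple (P : PolyData d f) : Prop :=
  P.IsCSimple ∧ ∀ i₀ : Fin f, ∃ W : PolyData (d+1) (f+1),
    W.IsProper ∧ W.IsWedgeOver P i₀ ∧ W.IsCSimple

end PolyData

/-- `k`-wedge-simplicity: `0`-wedge-simple means `C`-simple, and `P` is
`(k+1)`-wedge-simple if it is `C`-simple and over every facet there is a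
`k`-wedge-simple wedge.  In particular `1`-wedge-simple = wedge-simple. -/
def IsKWedgeSimpleAux : ℕ → (d f : ℕ) → PolyData d f → Prop
  | 0, _, _, P => P.IsCSimple
  | (k+1), d, f, P => P.IsCSimple ∧ ∀ i₀ : Fin f,
      ∃ W : PolyData (d+1) (f+1), W.IsProper ∧ W.IsWedgeOver P i₀ ∧
        IsKWedgeSimpleAux k (d+1) (f+1) W

def IsKWedgeSimple (k : ℕ) {d f : ℕ} (P : PolyData d f) : Prop :=
  IsKWedgeSimpleAux k d f P

namespace PolyData

variable {d : ℕ}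

/-- `(P, u, v)` is a Dantzig figure: a `d`-dimensional polyhedron with `2d`
facets, `d` of which are incident to the vertex `u` and the other `d` to the
vertex `v`. -/
def IsDantzigFigure (P : PolyData d (2*d)) (u v : Fin d → ℝ) : Prop :=
  P.IsVertex u ∧ P.IsVertex v ∧ Disjoint (P.activeAt u) (P.activeAt v) ∧
  P.activeAt u ∪ P.activeAt v = Set.univ ∧
  (P.activeAt u).ncard = d ∧ (P.activeAt v).ncard = d

end PolyData

/-- The (exposed) faces of a polyhedron, each obtained by turning a subset of
the inequalities into equations. -/
def PolyData.faces {d f : ℕ} (P : PolyData d f) : Set (Set (Fin d → ℝ)) :=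
  {F | ∃ S : Set (Fin f), F = {z ∈ P.toSet | S ⊆ P.activeAt z}}

/-- Combinatorial equivalence: an inclusion-preserving bijection between the
face lattices. -/
def CombEquiv {d f d' f' : ℕ} (P : PolyData d f) (Q : PolyData d' f') : Prop :=
  ∃ φ : Set (Fin d → ℝ) → Set (Fin d' → ℝ),
    Set.BijOn φ P.faces Q.faces ∧
    ∀ F ∈ P.faces, ∀ G ∈ P.faces, (F ⊆ G ↔ φ F ⊆ φ G)

/-- Two facets are adjacent if they share a ridge (a codimension-2 face). -/
def PolyData.AdjacentFacets {d f : ℕ} (P : PolyData d f) (i j : Fin f) : Prop :=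
  i ≠ j ∧ Module.finrank ℝ (affineSpan ℝ (P.facet i ∩ P.facet j)).direction = d - 2

/-- The Klee–Walkup polyhedron `U_4`. -/
def U4 : PolyData 4 8 where
  A := !![-6,-3,0,1; -3,-6,1,0; -35,-45,6,3; -45,-35,3,6;
          1,0,0,0; 0,1,0,0; 0,0,1,0; 0,0,0,1]
  b := ![-1,-1,-8,-8,0,0,0,0]

theorem AffineMap.map_add_smul {V W : Type*} [AddCommGroup V] [Module ℝ V] [AddCommGroup W]
    [Module ℝ W] (h : V →ᵃ[ℝ] W) (x v : V) (t : ℝ) :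
    h (x + t • v) = h x + t • h.linear v := by
  have := h.map_vadd x (t • v)
  simp only [vadd_eq_add, map_smul] at this
  rw [add_comm, this, add_comm]

/-- Finitely many nonnegative quantities stay nonnegative under a small perturbation that is
nonnegative on those which vanish. -/
theorem exists_pos_forall_add_mul_nonneg {ι : Type*} [Finite ι] (a b : ι → ℝ)
    (h : ∀ i, 0 < a i ∨ (0 ≤ a i ∧ 0 ≤ b i)) : ∃ ε > 0, ∀ i, 0 ≤ a i + ε * b i := by
  have key : ∀ᶠ ε in nhdsWithin (0 : ℝ) (Set.Ioi 0), ∀ i, 0 ≤ a i + ε * b i := by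
    refine Filter.eventually_all.2 fun i => ?_
    rcases h i with h | ⟨ha, hb⟩
    · have hc : ContinuousAt (fun ε : ℝ => a i + ε * b i) 0 := by fun_prop
      have := hc.eventually (lt_mem_nhds (a := 0) (by simpa using h))
      exact (this.filter_mono nhdsWithin_le_nhds).mono fun _ => le_of_lt
    · filter_upwards [self_mem_nhdsWithin] with ε hε
      have : 0 ≤ ε * b i := mul_nonneg (le_of_lt hε) hb
      linarith
  obtain ⟨ε, h1, h2⟩ := (key.and self_mem_nhdsWithin).exists
  exact ⟨ε, h2, h1⟩

namespace PolyData

section Basic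

variable {d f : ℕ} (P : PolyData d f)

/-- The `i`-th linear form, bundled. -/
def evalLin (i : Fin f) : (Fin d → ℝ) →ₗ[ℝ] ℝ where
  toFun := P.eval i
  map_add' x y := by simp [eval, mul_add, Finset.sum_add_distrib]
  map_smul' c x := by
    simp only [eval, Finset.mul_sum, Pi.smul_apply, smul_eq_mul, RingHom.id_apply]
    exact Finset.sum_congr rfl fun _ _ => by ring

@[simp] theorem evalLin_apply (i : Fin f) (z : Fin d → ℝ) : P.evalLin i z = P.eval i z := rfl

theorem eval_sub (i : Fin f) (x y : Fin d → ℝ) :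
    P.eval i (x - y) = P.eval i x - P.eval i y := (P.evalLin i).map_sub x y

theorem eval_smul (i : Fin f) (c : ℝ) (x : Fin d → ℝ) :
    P.eval i (c • x) = c * P.eval i x := (P.evalLin i).map_smul c x

/-- The slack of the `i`-th inequality, an affine function. -/
def slack (i : Fin f) : (Fin d → ℝ) →ᵃ[ℝ] ℝ :=
  (P.evalLin i).toAffineMap - AffineMap.const ℝ (Fin d → ℝ) (P.rhs i)

theorem slack_apply (i : Fin f) (z : Fin d → ℝ) : P.slack i z = P.eval i z - P.rhs i := rfl

theorem slack_linear (i : Fin f) (v : Fin d → ℝ) : (P.slack i).linear v = P.eval i v := by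
  simp [slack]

theorem slack_add_smul (i : Fin f) (x v : Fin d → ℝ) (t : ℝ) :
    P.slack i (x + t • v) = P.slack i x + t * P.eval i v := by
  rw [AffineMap.map_add_smul, slack_linear, smul_eq_mul]

theorem mem_toSet_iff {z : Fin d → ℝ} : z ∈ P.toSet ↔ ∀ i, 0 ≤ P.slack i z := by
  simp [toSet, slack_apply]

theorem mem_activeAt_iff {z : Fin d → ℝ} {i : Fin f} : i ∈ P.activeAt z ↔ P.slack i z = 0 := by
  simp [activeAt, slack_apply, sub_eq_zero]

variable {P}

theorem IsProper.exists_slack_pos (hP : P.IsProper) : ∃ z, ∀ i, 0 < P.slack i z := by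
  simpa [slack_apply] using hP.1

theorem IsProper.exists_facet_point (hP : P.IsProper) (i : Fin f) :
    ∃ z, P.slack i z = 0 ∧ ∀ i', i' ≠ i → 0 < P.slack i' z := by
  obtain ⟨z, -, h1, h2⟩ := hP.2 i
  exact ⟨z, by simp [slack_apply, h1], fun i' hi' => by simpa [slack_apply] using h2 i' hi'⟩

theorem isProper_of_slack (h : ∃ z, ∀ i, 0 < P.slack i z)
    (h' : ∀ i, ∃ z, P.slack i z = 0 ∧ ∀ i', i' ≠ i → 0 < P.slack i' z) : P.IsProper := by
  refine ⟨by simpa [slack_apply] using h, fun i => ?_⟩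
  obtain ⟨z, h1, h2⟩ := h' i
  refine ⟨z, P.mem_toSet_iff.2 fun i' => ?_, by simpa [slack_apply, sub_eq_zero] using h1,
    fun i' hi' => by simpa [slack_apply] using h2 i' hi'⟩
  rcases eq_or_ne i' i with rfl | hne
  · exact h1.ge
  · exact (h2 i' hne).le

theorem exists_pos_add_smul_mem {x v : Fin d → ℝ} (hx : x ∈ P.toSet)
    (hv : ∀ i ∈ P.activeAt x, P.eval i v = 0) :
    ∃ ε > 0, ∀ t : ℝ, |t| ≤ ε → x + t • v ∈ P.toSet := by
  obtain ⟨ε, hε, h⟩ := exists_pos_forall_add_mul_nonneg (fun i => P.slack i x)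
    (fun i => -|P.eval i v|) fun i => by
      rcases (P.mem_toSet_iff.1 hx i).eq_or_lt with h | h
      · exact .inr ⟨h.le, by simp [hv i (P.mem_activeAt_iff.2 h.symm)]⟩
      · exact .inl h
  refine ⟨ε, hε, fun t ht => P.mem_toSet_iff.2 fun i => ?_⟩
  rw [slack_add_smul]
  have h1 : |t * P.eval i v| ≤ ε * |P.eval i v| := by
    rw [abs_mul]; exact mul_le_mul_of_nonneg_right ht (abs_nonneg _)
  have h2 := h i
  have h3 := neg_abs_le (t * P.eval i v)
  linarith

/-- An affine function that is nonnegative on `P` and vanishes at `x` is constant along the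
directions of the face of `x`. -/
theorem linear_eq_zero_of_nonneg {h : (Fin d → ℝ) →ᵃ[ℝ] ℝ} (hh : ∀ z ∈ P.toSet, 0 ≤ h z)
    {x v : Fin d → ℝ} (hx : x ∈ P.toSet) (hx0 : h x = 0)
    (hv : ∀ i ∈ P.activeAt x, P.eval i v = 0) : h.linear v = 0 := by
  obtain ⟨ε, hε, H⟩ := exists_pos_add_smul_mem hx hv
  have h1 := hh _ (H ε (by rw [abs_of_pos hε]))
  have h2 := hh _ (H (-ε) (by rw [abs_neg, abs_of_pos hε]))
  rw [AffineMap.map_add_smul, hx0, smul_eq_mul] at h1 h2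
  nlinarith

/-- An affine function that is nonnegative on `P` and vanishes in the relative interior of a
facet is proportional to the slack of that facet. -/
theorem mul_slack_eq_of_nonneg {h : (Fin d → ℝ) →ᵃ[ℝ] ℝ} (hh : ∀ z ∈ P.toSet, 0 ≤ h z)
    {j : Fin f} {y : Fin d → ℝ} (hy : P.slack j y = 0) (hy' : ∀ i, i ≠ j → 0 < P.slack i y)
    (hy0 : h y = 0) {x₀ : Fin d → ℝ} (hx₀ : 0 < P.slack j x₀) (x : Fin d → ℝ) :
    h x = h x₀ / P.slack j x₀ * P.slack j x := by
  have hyP : y ∈ P.toSet := P.mem_toSet_iff.2 fun i => by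
    rcases eq_or_ne i j with rfl | hne
    · exact hy.ge
    · exact (hy' i hne).le
  have hA : ∀ (g : (Fin d → ℝ) →ᵃ[ℝ] ℝ) (z : Fin d → ℝ), g.linear (z - y) = g z - g y :=
    fun g z => g.linearMap_vsub z y
  have hS : ∀ z, P.eval j (z - y) = P.slack j z := fun z => by
    rw [← slack_linear, hA, hy, sub_zero]
  have := linear_eq_zero_of_nonneg hh hyP hy0
    (v := (x - y) - (P.slack j x / P.slack j x₀) • (x₀ - y)) fun i hi => by
      obtain rfl : i = j := by
        by_contra hne
        exact (hy' i hne).ne' (P.mem_activeAt_iff.1 hi)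
      rw [eval_sub, eval_smul, hS, hS, div_mul_cancel₀ _ hx₀.ne', sub_self]
  rw [map_sub, map_smul, hA, hA, hy0, smul_eq_mul] at this
  field_simp at this ⊢
  linarith

end Basic

/-- Every maximal circuit step enters exactly one new facet. -/
def IsStepSimple {d f : ℕ} (P : PolyData d f) : Prop :=
  ∀ y ∈ P.toSet, ∀ g ∈ P.circuits, ∀ α : ℝ, 0 < α → y + α • g ∈ P.toSet →
    (∀ β : ℝ, α < β → y + β • g ∉ P.toSet) →
    (P.activeAt (y + α • g) \ P.activeAt y).ncard = 1

theorem IsStepSimple.isSimpleWalk {d f : ℕ} {P : PolyData d f} (h : P.IsStepSimple) {k : ℕ}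
    {y : Fin (k + 1) → Fin d → ℝ} (hy : P.IsCircuitWalk y) : P.IsSimpleWalk y := by
  intro i
  obtain ⟨g, hg, α, hα, heq, hmax⟩ := hy.2 i
  have := hy.1 i.succ
  rw [heq] at this ⊢
  exact h _ (hy.1 _) g hg α hα this hmax

theorem IsCSimple.isStepSimple {d f : ℕ} {P : PolyData d f} (h : P.IsCSimple)
    (hΔ : 1 ≤ maxEdgeDiameter f d) : P.IsStepSimple := by
  intro y hy g hg α hα hyα hmax
  have := h 1 (by simpa using hΔ) ![y, y + α • g]
    ⟨by simp [Fin.forall_fin_two, hy, hyα], by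
      intro i
      obtain rfl := Subsingleton.elim i 0
      exact ⟨g, hg, α, hα, rfl, hmax⟩⟩ 0
  exact this

section Face

variable {d f d' f' : ℕ} {P : PolyData d f} {Q : PolyData d' f'}
  {T : (Fin d' → ℝ) →ᵃ[ℝ] (Fin d → ℝ)} {x₀ : Fin d' → ℝ}

theorem mem_image_of_isExtreme (hE : IsExtreme ℝ P.toSet (T '' Q.toSet))
    (hx₀ : ∀ j, 0 < Q.slack j x₀) {y : Fin d → ℝ} (hy : y ∈ P.toSet)
    (h : ∀ i ∈ P.activeAt (T x₀), P.eval i (y - T x₀) = 0) : y ∈ T '' Q.toSet := by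
  have hx₀Q : x₀ ∈ Q.toSet := Q.mem_toSet_iff.2 fun j => (hx₀ j).le
  obtain ⟨ε, hε, H⟩ := exists_pos_add_smul_mem (hE.subset ⟨x₀, hx₀Q, rfl⟩) h
  refine hE.left_mem_of_mem_openSegment hy (H (-ε) (by rw [abs_neg, abs_of_pos hε]))
    ⟨x₀, hx₀Q, rfl⟩
    ⟨ε / (1 + ε), 1 / (1 + ε), by positivity, by positivity, by field_simp; ring, ?_⟩
  ext k
  simp only [Pi.add_apply, Pi.smul_apply, Pi.sub_apply, smul_eq_mul]
  field_simp
  ring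

theorem eval_map_linear_eq_zero (hE : IsExtreme ℝ P.toSet (T '' Q.toSet))
    (hx₀ : ∀ j, 0 < Q.slack j x₀) {i : Fin f} (hi : i ∈ P.activeAt (T x₀)) (v : Fin d' → ℝ) :
    P.eval i (T.linear v) = 0 := by
  rw [← slack_linear]
  refine linear_eq_zero_of_nonneg (P := Q) (h := (P.slack i).comp T) (x := x₀) (v := v)
    (fun z hz => P.mem_toSet_iff.1 (hE.subset ⟨z, hz, rfl⟩) i)
    (Q.mem_toSet_iff.2 fun j => (hx₀ j).le) (P.mem_activeAt_iff.1 hi) fun j hj => ?_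
  exact absurd (Q.mem_activeAt_iff.1 hj) (hx₀ j).ne'

theorem map_mem_toSet_iff (hT : Function.Injective T)
    (hE : IsExtreme ℝ P.toSet (T '' Q.toSet)) (hx₀ : ∀ j, 0 < Q.slack j x₀) {x : Fin d' → ℝ} :
    T x ∈ P.toSet ↔ x ∈ Q.toSet := by
  refine ⟨fun hx => ?_, fun hx => hE.subset ⟨x, hx, rfl⟩⟩
  obtain ⟨x', hx', h⟩ := mem_image_of_isExtreme hE hx₀ hx fun i hi => by
    have : T x - T x₀ = T.linear (x - x₀) := (T.linearMap_vsub x x₀).symm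
    rw [this, eval_map_linear_eq_zero hE hx₀ hi]
  rwa [← hT h]

theorem exists_map_linear_eq (hE : IsExtreme ℝ P.toSet (T '' Q.toSet))
    (hx₀ : ∀ j, 0 < Q.slack j x₀) {v : Fin d → ℝ}
    (hv : ∀ i ∈ P.activeAt (T x₀), P.eval i v = 0) : ∃ v', T.linear v' = v := by
  have hx₀Q : x₀ ∈ Q.toSet := Q.mem_toSet_iff.2 fun j => (hx₀ j).le
  obtain ⟨ε, hε, H⟩ := exists_pos_add_smul_mem (hE.subset ⟨x₀, hx₀Q, rfl⟩) hv
  obtain ⟨x', -, h⟩ := mem_image_of_isExtreme hE hx₀ (H ε (by rw [abs_of_pos hε])) fun i hi => by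
    rw [add_sub_cancel_left, eval_smul, hv i hi, mul_zero]
  refine ⟨ε⁻¹ • (x' - x₀), ?_⟩
  have : T.linear (x' - x₀) = T x' - T x₀ := T.linearMap_vsub x' x₀
  rw [map_smul, this, h, add_sub_cancel_left, inv_smul_smul₀ hε.ne']

/-- Every facet inequality of a face is induced by an inequality of the polyhedron. -/
theorem exists_slack_map_eq (hQ : Q.IsProper) (hT : Function.Injective T)
    (hE : IsExtreme ℝ P.toSet (T '' Q.toSet)) (hx₀ : ∀ j, 0 < Q.slack j x₀) (j : Fin f') :
    ∃ i, ∃ μ > 0, ∀ x, P.slack i (T x) = μ * Q.slack j x := by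
  obtain ⟨y, hy, hy'⟩ := hQ.exists_facet_point j
  have hyQ : y ∈ Q.toSet := Q.mem_toSet_iff.2 fun i => by
    rcases eq_or_ne i j with rfl | hne
    · exact hy.ge
    · exact (hy' i hne).le
  have hnn : ∀ i, ∀ x ∈ Q.toSet, 0 ≤ (P.slack i).comp T x := fun i x hx =>
    P.mem_toSet_iff.1 (hE.subset ⟨x, hx, rfl⟩) i
  have hx₀Q : x₀ ∈ Q.toSet := Q.mem_toSet_iff.2 fun j => (hx₀ j).le
  obtain ⟨i, hi, hi'⟩ : ∃ i, P.slack i (T y) = 0 ∧ 0 < P.slack i (T x₀) := by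
    by_contra! hcon
    obtain ⟨ε, hε, H⟩ := exists_pos_forall_add_mul_nonneg (fun i => P.slack i (T y))
      (fun i => P.eval i (T.linear (y - x₀))) fun i => by
        rcases (hnn i y hyQ).eq_or_lt with h | h
        · refine .inr ⟨h.le, ?_⟩
          have h1 := hcon i h.symm
          have h2 : T.linear (y - x₀) = T y - T x₀ := T.linearMap_vsub y x₀
          have h3 : P.slack i (T y) = 0 := h.symm
          rw [h2, eval_sub]
          rw [slack_apply] at h1 h3
          linarith
        · exact .inl h
    have hmem : T (y + ε • (y - x₀)) ∈ P.toSet := P.mem_toSet_iff.2 fun i => by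
      rw [T.map_add_smul, slack_add_smul]
      exact H i
    have h1 := Q.mem_toSet_iff.1 ((map_mem_toSet_iff hT hE hx₀).1 hmem) j
    have h2 := hx₀ j
    rw [slack_add_smul, hy, eval_sub] at h1
    rw [slack_apply] at h2 hy
    nlinarith
  exact ⟨i, _, div_pos hi' (hx₀ j),
    mul_slack_eq_of_nonneg (h := (P.slack i).comp T) (hnn i) hy hy' hi (hx₀ j)⟩

theorem injective_of_slack_map_eq (hQ : Q.IsProper) {e : Fin f' → Fin f} {μ : Fin f' → ℝ}
    (hμ : ∀ j, 0 < μ j) (he : ∀ j x, P.slack (e j) (T x) = μ j * Q.slack j x) :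
    Function.Injective e := by
  intro j k hjk
  by_contra hne
  obtain ⟨y, hy, hy'⟩ := hQ.exists_facet_point j
  have h := he k y
  rw [← hjk, he, hy, mul_zero] at h
  exact (mul_pos (hμ k) (hy' k (Ne.symm hne))).ne h

theorem IsStepSimple.of_isExtreme (hP : P.IsStepSimple) (hQ : Q.IsProper)
    (hT : Function.Injective T) (hE : IsExtreme ℝ P.toSet (T '' Q.toSet)) : Q.IsStepSimple := by
  intro y hy g hg α hα hyα hmax
  obtain ⟨x₀, hx₀⟩ := hQ.exists_slack_pos
  choose e μ hμ he using exists_slack_map_eq hQ hT hE hx₀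
  have heval : ∀ j v, P.eval (e j) (T.linear v) = μ j * Q.eval j v := fun j v => by
    have h1 := he j (x₀ + (1 : ℝ) • v)
    rw [T.map_add_smul, slack_add_smul, slack_add_smul, he] at h1
    linarith
  obtain ⟨j₀, hj₀, hj₀'⟩ : ∃ j, Q.slack j (y + α • g) = 0 ∧ Q.eval j g < 0 := by
    by_contra! hcon
    obtain ⟨ε, hε, H⟩ := exists_pos_forall_add_mul_nonneg (fun j => Q.slack j (y + α • g))
      (fun j => Q.eval j g) fun j => by
        rcases (Q.mem_toSet_iff.1 hyα j).eq_or_lt with h | h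
        · exact .inr ⟨h.le, hcon j h.symm⟩
        · exact .inl h
    refine hmax (α + ε) (by linarith) (Q.mem_toSet_iff.2 fun j => ?_)
    rw [add_smul, ← add_assoc, slack_add_smul]
    exact H j
  have hLg : T.linear g ∈ P.circuits := by
    have hL : Function.Injective T.linear := T.linear_injective_iff.2 hT
    refine ⟨fun h0 => hg.1 (hL (h0.trans (map_zero _).symm)), fun x hx hsub => ?_⟩
    obtain ⟨x', rfl⟩ := exists_map_linear_eq hE hx₀ (v := x) fun i hi => by
      by_contra hne
      exact hsub hne (eval_map_linear_eq_zero hE hx₀ hi g)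
    obtain ⟨c, rfl⟩ : ∃ c : ℝ, x' = c • g := by
      refine ⟨Q.eval j₀ x' / Q.eval j₀ g, ?_⟩
      by_contra hne
      have hsupp := hg.2 (x' - (Q.eval j₀ x' / Q.eval j₀ g) • g) (sub_ne_zero.2 hne)
          fun j hj hj' => by
        have h1 : P.eval (e j) (T.linear x') = 0 := by
          by_contra h
          exact hsub h (by rw [heval, hj', mul_zero])
        rw [heval, mul_eq_zero, or_iff_right (hμ j).ne'] at h1
        exact hj (by rw [eval_sub, eval_smul, hj', h1, mul_zero, sub_zero])
      have : j₀ ∈ {j | Q.eval j g ≠ 0} := hj₀'.ne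
      rw [← hsupp] at this
      refine this ?_
      rw [eval_sub, eval_smul, div_mul_cancel₀ _ hj₀'.ne, sub_self]
    have hc : c ≠ 0 := by
      rintro rfl
      simp at hx
    ext i
    simp [eval_smul, hc]
  have hcard := hP (T y) (hE.subset ⟨y, hy, rfl⟩) _ hLg α hα
    (by rw [← T.map_add_smul]; exact hE.subset ⟨_, hyα, rfl⟩)
    fun β hβ hmem => hmax β hβ (by
      rwa [← T.map_add_smul, map_mem_toSet_iff hT hE hx₀] at hmem)
  rw [← T.map_add_smul] at hcard
  have hact : ∀ j x, e j ∈ P.activeAt (T x) ↔ j ∈ Q.activeAt x := fun j x => by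
    rw [mem_activeAt_iff, mem_activeAt_iff, he, mul_eq_zero, or_iff_right (hμ j).ne']
  refine le_antisymm ?_ ?_
  · rw [← hcard]
    refine Set.ncard_le_ncard_of_injOn e (fun j hj => ?_)
      (injective_of_slack_map_eq hQ hμ he).injOn (Set.toFinite _)
    exact ⟨(hact _ _).2 hj.1, fun h => hj.2 ((hact _ _).1 h)⟩
  · refine (Set.ncard_pos (Set.toFinite _)).2 ⟨j₀, Q.mem_activeAt_iff.2 hj₀, fun h => ?_⟩
    rw [mem_activeAt_iff] at h
    rw [slack_add_smul, h, zero_add] at hj₀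
    exact (mul_neg_of_pos_of_neg hα hj₀').ne hj₀

theorem card_facets_add_le (hQ : Q.IsProper)
    (hT : Function.Injective T) (hE : IsExtreme ℝ P.toSet (T '' Q.toSet)) :
    f' + d ≤ f + d' := by
  classical
  obtain ⟨x₀, hx₀⟩ := hQ.exists_slack_pos
  choose e μ hμ he using exists_slack_map_eq hQ hT hE hx₀
  have h1 : Fintype.card (Fin f') ≤ Fintype.card {i // ¬ i ∈ P.activeAt (T x₀)} := by
    refine Fintype.card_le_of_injective (fun j => ⟨e j, fun h => ?_⟩) fun j k hjk =>
      injective_of_slack_map_eq hQ hμ he (congrArg Subtype.val hjk)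
    rw [mem_activeAt_iff, he] at h
    exact (mul_pos (hμ j) (hx₀ j)).ne' h
  have h2 := Fintype.card_subtype_compl (fun i => i ∈ P.activeAt (T x₀))
  have h3 := Fintype.card_subtype_le (fun i => i ∈ P.activeAt (T x₀))
  let φ : (Fin d → ℝ) →ₗ[ℝ] ({i // i ∈ P.activeAt (T x₀)} → ℝ) :=
    LinearMap.pi fun i => P.evalLin i
  have h4 := φ.finrank_range_add_finrank_ker
  have h5 : Module.finrank ℝ (LinearMap.range φ) ≤ Fintype.card {i // i ∈ P.activeAt (T x₀)} := by
    simpa using (LinearMap.range φ).finrank_le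
  have h6 : LinearMap.ker φ ≤ LinearMap.range T.linear := fun v hv =>
    exists_map_linear_eq hE hx₀ fun i hi => congrFun (LinearMap.mem_ker.1 hv) ⟨i, hi⟩
  have h7 := (Submodule.finrank_mono h6).trans T.linear.finrank_range_le
  simp only [Module.finrank_fintype_fun_eq_card, Fintype.card_fin] at *
  omega

end Face

section EdgeDiameter

variable {d f : ℕ}

theorem IsVertex.eq_of_card_le {P : PolyData d f} (hf : f ≤ d) {u v : Fin d → ℝ}
    (hu : P.IsVertex u) (hv : P.IsVertex v) : u = v := by
  have huniv : ∀ w, P.IsVertex w → ∀ i, i ∈ P.activeAt w := by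
    intro w hw
    by_contra! hcon
    obtain ⟨i, hi⟩ := hcon
    have h1 : Module.finrank ℝ (Submodule.span ℝ (P.row '' P.activeAt w)) ≤
        (P.row '' P.activeAt w).ncard := by
      classical
      have := (P.row '' P.activeAt w).toFinite.fintype
      rw [Set.ncard_eq_toFinset_card']
      exact finrank_span_le_card _
    rw [hw.2, finrank_top, Module.finrank_fintype_fun_eq_card, Fintype.card_fin] at h1
    have h2 : (P.row '' P.activeAt w).ncard ≤ (P.activeAt w).ncard :=
      Set.ncard_image_le (Set.toFinite _)
    have h3 : (P.activeAt w).ncard < f := by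
      have := Set.ncard_lt_card (s := P.activeAt w) (fun h => hi (h ▸ Set.mem_univ i))
      simpa using this
    omega
  have hrow : ∀ r ∈ Submodule.span ℝ (P.row '' P.activeAt u), r ⬝ᵥ (u - v) = 0 := by
    intro r hr
    induction hr using Submodule.span_induction with
    | mem r hr =>
      obtain ⟨i, -, rfl⟩ := hr
      have : P.eval i (u - v) = 0 := by
        have h1 : P.eval i u = P.rhs i := huniv u hu i
        have h2 : P.eval i v = P.rhs i := huniv v hv i
        rw [eval_sub, h1, h2, sub_self]
      exact this
    | zero => exact zero_dotProduct _
    | add r s _ _ hr hs => rw [add_dotProduct, hr, hs, add_zero]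
    | smul c r _ hr => rw [smul_dotProduct, hr, smul_zero]
  rw [hu.2] at hrow
  exact sub_eq_zero.1 (dotProduct_self_eq_zero.1 (hrow (u - v) trivial))

theorem edgeDistance_self (P : PolyData d f) (u : Fin d → ℝ) : P.edgeDistance u u = 0 := by
  refine le_antisymm (sInf_le ⟨0, by simp, fun _ => u, fun i => i.elim0, rfl, rfl⟩) bot_le

theorem one_le_edgeDistance (P : PolyData d f) {u v : Fin d → ℝ} (h : u ≠ v) :
    1 ≤ P.edgeDistance u v := by
  refine le_sInf ?_
  rintro n ⟨k, rfl, y, -, rfl, rfl⟩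
  rcases Nat.eq_zero_or_pos k with rfl | hk
  · exact absurd rfl h
  · exact_mod_cast hk

theorem lt_of_one_le_maxEdgeDiameter (h : 1 ≤ maxEdgeDiameter f d) : d < f := by
  by_contra! hf
  have : maxEdgeDiameter f d ≤ 0 := by
    refine iSup₂_le fun P _ => iSup₂_le fun u v => iSup₂_le fun hu hv => ?_
    rw [hu.eq_of_card_le hf hv, edgeDistance_self]
  exact absurd (h.trans this) (by simp)

theorem one_le_maxEdgeDiameter_of_vertices {P : PolyData d f} (hP : P.IsProper)
    {u v : Fin d → ℝ} (hu : P.IsVertex u) (hv : P.IsVertex v) (huv : u ≠ v) :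
    1 ≤ maxEdgeDiameter f d := by
  refine (P.one_le_edgeDistance huv).trans ?_
  refine le_trans ?_ (le_iSup₂ (f := fun (P : PolyData d f) (_ : P.IsProper) => P.edgeDiameter)
    P hP)
  unfold edgeDiameter
  exact le_iSup₂_of_le u v (le_iSup₂_of_le hu hv le_rfl)

end EdgeDiameter

section Parabola

/-- The polyhedron in `ℝ^{n+2}` given by `x₀ ≥ -1`, `x_k ≥ 0` for `k ≥ 2`, and the tangents
`x₁ ≥ 2 s x₀ - s²` to a parabola, for `s = 0, …, m + 1`. -/
def parabola (n m : ℕ) : PolyData (n + 2) (n + 3 + m) where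
  A i j :=
    if i.val = 0 then (if j.val = 0 then 1 else 0)
    else if i.val ≤ n then (if j.val = i.val + 1 then 1 else 0)
    else if j.val = 0 then -2 * ((i.val : ℚ) - (n + 1)) else if j.val = 1 then 1 else 0
  b i := if i.val = 0 then -1 else if i.val ≤ n then 0 else -((i.val : ℚ) - (n + 1)) ^ 2

variable {n m : ℕ}

theorem slack_parabola_zero {i : Fin (n + 3 + m)} (hi : i.val = 0) (z : Fin (n + 2) → ℝ) :
    (parabola n m).slack i z = z 0 + 1 := by
  rw [slack_apply, eval, Fin.sum_univ_succ]
  simp [-Fin.val_eq_zero_iff, row, rhs, parabola, hi]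

theorem slack_parabola_coord {i : Fin (n + 3 + m)} (h0 : i.val ≠ 0) (hi : i.val ≤ n)
    (z : Fin (n + 2) → ℝ) :
    (parabola n m).slack i z = z ⟨i.val + 1, by omega⟩ := by
  rw [slack_apply, eval, Finset.sum_eq_single ⟨i.val + 1, by omega⟩]
  · simp [-Fin.val_eq_zero_iff, row, rhs, parabola, hi, h0]
  · intro j _ hj
    have : j.val ≠ i.val + 1 := fun h => hj (Fin.ext h)
    simp [-Fin.val_eq_zero_iff, row, parabola, hi, h0, this]
  · simp

theorem slack_parabola_tangent {i : Fin (n + 3 + m)} (hi : n < i.val) (z : Fin (n + 2) → ℝ) :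
    (parabola n m).slack i z =
      z 1 - 2 * ((i.val : ℝ) - (n + 1)) * z 0 + ((i.val : ℝ) - (n + 1)) ^ 2 := by
  have h0 : i.val ≠ 0 := by omega
  rw [slack_apply, eval, Fin.sum_univ_succ, Fin.sum_univ_succ]
  simp [-Fin.val_eq_zero_iff, row, rhs, parabola, hi.not_ge, h0]
  ring

/-- The vector `(a, b, c, …)` with trailing coordinates given by `c`. -/
def consTwo {n : ℕ} (a b : ℝ) (c : Fin n → ℝ) : Fin (n + 2) → ℝ := Fin.cons a (Fin.cons b c)

@[simp] theorem consTwo_zero (a b : ℝ) (c : Fin n → ℝ) : consTwo a b c 0 = a := rfl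

@[simp] theorem consTwo_one (a b : ℝ) (c : Fin n → ℝ) : consTwo a b c 1 = b := rfl

theorem consTwo_mk (a b : ℝ) (c : Fin n → ℝ) {k : ℕ} (h0 : k ≠ 0) (hk : k ≤ n) :
    consTwo a b c ⟨k + 1, by omega⟩ = c ⟨k - 1, by omega⟩ := by
  obtain ⟨k, rfl⟩ := Nat.exists_eq_succ_of_ne_zero h0
  rfl

theorem parabola_cases (i : Fin (n + 3 + m)) :
    i.val = 0 ∨ (i.val ≠ 0 ∧ i.val ≤ n) ∨ n < i.val := by omega

theorem parabola_isProper : (parabola n m).IsProper := by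
  refine isProper_of_slack ⟨consTwo 0 1 1, fun i => ?_⟩ fun i => ?_
  · rcases parabola_cases i with h | ⟨h0, h⟩ | h
    · rw [slack_parabola_zero h]; simp
    · rw [slack_parabola_coord h0 h, consTwo_mk _ _ _ h0 h]; simp
    · rw [slack_parabola_tangent h, consTwo_zero, consTwo_one]
      nlinarith [sq_nonneg ((i.val : ℝ) - (n + 1))]
  · rcases parabola_cases i with h | ⟨h0, h⟩ | h
    · refine ⟨consTwo (-1) 1 1, by rw [slack_parabola_zero h]; simp, fun j hj => ?_⟩
      rcases parabola_cases j with h' | ⟨h0', h'⟩ | h'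
      · exact absurd (Fin.ext (h'.trans h.symm)) hj
      · rw [slack_parabola_coord h0' h', consTwo_mk _ _ _ h0' h']; simp
      · rw [slack_parabola_tangent h']
        have : (n : ℝ) + 1 ≤ j.val := by exact_mod_cast h'
        simp only [consTwo_zero, consTwo_one]
        nlinarith [sq_nonneg ((j.val : ℝ) - (n + 1))]
    · refine ⟨consTwo 0 1 (Function.update 1 ⟨i.val - 1, by omega⟩ 0), by
        rw [slack_parabola_coord h0 h, consTwo_mk _ _ _ h0 h]; simp, fun j hj => ?_⟩
      rcases parabola_cases j with h' | ⟨h0', h'⟩ | h'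
      · rw [slack_parabola_zero h']; simp
      · rw [slack_parabola_coord h0' h', consTwo_mk _ _ _ h0' h', Function.update_of_ne]
        · simp
        · intro heq
          have := congrArg Fin.val heq
          exact hj (Fin.ext (by simp only at this; omega))
      · rw [slack_parabola_tangent h', consTwo_zero, consTwo_one]
        nlinarith [sq_nonneg ((j.val : ℝ) - (n + 1))]
    · have hi : (n : ℝ) + 1 ≤ i.val := by exact_mod_cast h
      refine ⟨consTwo ((i.val : ℝ) - (n + 1)) (((i.val : ℝ) - (n + 1)) ^ 2) 1, by
        rw [slack_parabola_tangent h]; simp only [consTwo_zero, consTwo_one]; ring,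
        fun j hj => ?_⟩
      rcases parabola_cases j with h' | ⟨h0', h'⟩ | h'
      · rw [slack_parabola_zero h']; simp only [consTwo_zero]; linarith
      · rw [slack_parabola_coord h0' h', consTwo_mk _ _ _ h0' h']; simp
      · rw [slack_parabola_tangent h']
        simp only [consTwo_zero, consTwo_one]
        have : 0 < ((i.val : ℝ) - j.val) ^ 2 := by
          refine sq_pos_of_ne_zero (sub_ne_zero.2 fun h => hj (Fin.ext ?_))
          exact_mod_cast h.symm
        nlinarith

/-- A feasible point is a vertex as soon as the active linear forms have no common zero. -/
theorem isVertex_of_forall_eval {d f : ℕ} {P : PolyData d f} {v : Fin d → ℝ}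
    (hv : v ∈ P.toSet) (h : ∀ x, (∀ i ∈ P.activeAt v, P.eval i x = 0) → x = 0) :
    P.IsVertex v := by
  refine ⟨hv, ?_⟩
  by_contra hne
  obtain ⟨φ, hφ, hle⟩ := Submodule.exists_le_ker_of_lt_top _ (lt_top_iff_ne_top.2 hne)
  have hφx : ∀ y, φ y = y ⬝ᵥ fun j => φ (Pi.single j 1) := fun y => by
    conv_lhs => rw [pi_eq_sum_univ' y]
    simp [dotProduct]
  refine hφ (LinearMap.ext fun y => ?_)
  have := h (fun j => φ (Pi.single j 1)) fun i hi => by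
    have h1 := hle (Submodule.subset_span ⟨i, hi, rfl⟩)
    rw [LinearMap.mem_ker, hφx] at h1
    exact h1
  rw [hφx, this, dotProduct_zero, LinearMap.zero_apply]

theorem eval_eq_slack_sub {d f : ℕ} (P : PolyData d f) (i : Fin f) (x : Fin d → ℝ) :
    P.eval i x = P.slack i x - P.slack i 0 := by
  have := (P.evalLin i).map_zero
  rw [evalLin_apply] at this
  rw [slack_apply, slack_apply, this]
  ring

theorem parabola_isVertex {a : ℝ} {i₁ i₂ : Fin (n + 3 + m)}
    (hmem : consTwo a 0 0 ∈ (parabola n m).toSet)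
    (hi₁ : i₁ ∈ (parabola n m).activeAt (consTwo a 0 0))
    (hi₂ : i₂ ∈ (parabola n m).activeAt (consTwo a 0 0))
    (h : ∀ x, (parabola n m).eval i₁ x = 0 → (parabola n m).eval i₂ x = 0 → x 0 = 0 ∧ x 1 = 0) :
    (parabola n m).IsVertex (consTwo a 0 0) := by
  refine isVertex_of_forall_eval hmem fun x hx => ?_
  obtain ⟨h0, h1⟩ := h x (hx _ hi₁) (hx _ hi₂)
  ext k
  refine Fin.cases h0 (fun k => Fin.cases h1 (fun k => ?_) k) k
  have hk0 : k.val + 1 ≠ 0 := by omega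
  have hkn : k.val + 1 ≤ n := k.2
  have := hx ⟨k.val + 1, by omega⟩ (by
    rw [mem_activeAt_iff, slack_parabola_coord hk0 hkn, consTwo_mk _ _ _ hk0 hkn]
    rfl)
  rw [eval_eq_slack_sub, slack_parabola_coord hk0 hkn, slack_parabola_coord hk0 hkn, Pi.zero_apply,
    sub_zero] at this
  exact this

theorem one_le_maxEdgeDiameter {d f : ℕ} (hd : 2 ≤ d) (hf : d < f) : 1 ≤ maxEdgeDiameter f d := by
  obtain ⟨n, rfl⟩ := Nat.exists_eq_add_of_le' hd
  obtain ⟨m, rfl⟩ : ∃ m, f = n + 3 + m := ⟨f - (n + 3), by omega⟩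
  have hge : ∀ {k : Fin (n + 3 + m)}, n < k.val → k.val = n + 1 ∨ (n : ℝ) + 2 ≤ k.val := by
    intro k hk
    rcases Nat.lt_or_ge (n + 1) k.val with h | h
    · right; exact_mod_cast h
    · left; omega
  have h0 : ((⟨0, by omega⟩ : Fin (n + 3 + m)) : ℕ) = 0 := rfl
  have h1 : n < ((⟨n + 1, by omega⟩ : Fin (n + 3 + m)) : ℕ) := by simp
  have h2 : n < ((⟨n + 2, by omega⟩ : Fin (n + 3 + m)) : ℕ) := by simp
  refine one_le_maxEdgeDiameter_of_vertices (parabola_isProper (n := n) (m := m))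
    (u := consTwo (-1) 0 0) (v := consTwo (1 / 2) 0 0)
    (parabola_isVertex (i₁ := ⟨0, by omega⟩) (i₂ := ⟨n + 1, by omega⟩) ?_ ?_ ?_ ?_)
    (parabola_isVertex (i₁ := ⟨n + 1, by omega⟩) (i₂ := ⟨n + 2, by omega⟩) ?_ ?_ ?_ ?_)
    fun h => by have := congrFun h 0; norm_num at this
  · refine (mem_toSet_iff _).2 fun k => ?_
    rcases parabola_cases k with h | ⟨h0, h⟩ | h
    · rw [slack_parabola_zero h]; simp
    · rw [slack_parabola_coord h0 h, consTwo_mk _ _ _ h0 h]; simp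
    · rw [slack_parabola_tangent h]
      have : (n : ℝ) + 1 ≤ k.val := by exact_mod_cast h
      simp only [consTwo_zero, consTwo_one]
      nlinarith [sq_nonneg ((k.val : ℝ) - (n + 1))]
  · rw [mem_activeAt_iff, slack_parabola_zero h0]; simp
  · rw [mem_activeAt_iff, slack_parabola_tangent h1]; simp
  · intro x hx hx'
    rw [eval_eq_slack_sub, slack_parabola_zero h0, slack_parabola_zero h0] at hx
    rw [eval_eq_slack_sub, slack_parabola_tangent h1, slack_parabola_tangent h1] at hx'
    simp at hx hx'
    exact ⟨hx, hx'⟩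
  · refine (mem_toSet_iff _).2 fun k => ?_
    rcases parabola_cases k with h | ⟨h0, h⟩ | h
    · rw [slack_parabola_zero h]; norm_num
    · rw [slack_parabola_coord h0 h, consTwo_mk _ _ _ h0 h]; simp
    · rw [slack_parabola_tangent h]
      simp only [consTwo_zero, consTwo_one]
      rcases hge h with h | h
      · rw [h]; push_cast; norm_num
      · nlinarith
  · rw [mem_activeAt_iff, slack_parabola_tangent h1]; simp
  · rw [mem_activeAt_iff, slack_parabola_tangent h2]; simp; ring
  · intro x hx hx'
    rw [eval_eq_slack_sub, slack_parabola_tangent h1, slack_parabola_tangent h1] at hx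
    rw [eval_eq_slack_sub, slack_parabola_tangent h2, slack_parabola_tangent h2] at hx'
    simp at hx hx'
    exact ⟨by linarith, hx⟩

end Parabola
end PolyData

section SnocVec

variable {d : ℕ}

@[simp] theorem snocVec_castSucc (z : Fin d → ℝ) (t : ℝ) (j : Fin d) :
    snocVec z t j.castSucc = z j := Fin.snoc_castSucc ..

@[simp] theorem snocVec_last (z : Fin d → ℝ) (t : ℝ) : snocVec z t (Fin.last d) = t :=
  Fin.snoc_last ..

@[simp] theorem init_snocVec (z : Fin d → ℝ) (t : ℝ) : Fin.init (snocVec z t) = z :=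
  Fin.init_snoc ..

theorem snocVec_init (w : Fin (d + 1) → ℝ) : snocVec (Fin.init w) (w (Fin.last d)) = w :=
  Fin.snoc_init_self w

theorem exists_eq_snocVec (w : Fin (d + 1) → ℝ) : ∃ z t, w = snocVec z t :=
  ⟨_, _, (snocVec_init w).symm⟩

theorem snocVec_inj {z z' : Fin d → ℝ} {t t' : ℝ} :
    snocVec z t = snocVec z' t' ↔ z = z' ∧ t = t' :=
  ⟨fun h => ⟨by simpa using congrArg Fin.init h, by simpa using congrFun h (Fin.last d)⟩,
    fun h => by rw [h.1, h.2]⟩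

theorem sum_mul_snocVec (a : Fin (d + 1) → ℝ) (z : Fin d → ℝ) (t : ℝ) :
    ∑ j, a j * snocVec z t j = ∑ j, a j.castSucc * z j + a (Fin.last d) * t := by
  simp [Fin.sum_univ_castSucc]

end SnocVec

/-- The affine map `(x, s) ↦ (T x, c s)`. -/
def AffineMap.snocMap {d d' : ℕ} (T : (Fin d' → ℝ) →ᵃ[ℝ] (Fin d → ℝ)) (c : ℝ) :
    (Fin (d' + 1) → ℝ) →ᵃ[ℝ] (Fin (d + 1) → ℝ) where
  toFun w := snocVec (T (Fin.init w)) (c * w (Fin.last d'))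
  linear :=
    { toFun := fun w => snocVec (T.linear (Fin.init w)) (c * w (Fin.last d'))
      map_add' := fun v w => by
        have : Fin.init (v + w) = Fin.init v + Fin.init w := rfl
        ext j
        refine Fin.lastCases ?_ (fun j => ?_) j
        · simp [mul_add]
        · simp [this]
      map_smul' := fun r w => by
        have : Fin.init (r • w) = r • Fin.init w := rfl
        ext j
        refine Fin.lastCases ?_ (fun j => ?_) j
        · simp only [snocVec_last, Pi.smul_apply, smul_eq_mul, RingHom.id_apply]; ring
        · simp [this] }
  map_vadd' w v := by
    ext j
    refine Fin.lastCases ?_ (fun j => ?_) j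
    · simp [mul_add]
    · have h := T.map_vadd (Fin.init w) (Fin.init v)
      have : Fin.init (v + w) = Fin.init v + Fin.init w := rfl
      simp only [vadd_eq_add] at h
      simp [this, h]

theorem AffineMap.snocMap_apply {d d' : ℕ} (T : (Fin d' → ℝ) →ᵃ[ℝ] (Fin d → ℝ)) (c : ℝ)
    (x : Fin d' → ℝ) (s : ℝ) : T.snocMap c (snocVec x s) = snocVec (T x) (c * s) := by
  change snocVec _ _ = _
  simp

theorem AffineMap.snocMap_injective {d d' : ℕ} {T : (Fin d' → ℝ) →ᵃ[ℝ] (Fin d → ℝ)} {c : ℝ}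
    (hT : Function.Injective T) (hc : c ≠ 0) : Function.Injective (T.snocMap c) := by
  intro v w h
  obtain ⟨x, s, rfl⟩ := exists_eq_snocVec v
  obtain ⟨y, t, rfl⟩ := exists_eq_snocVec w
  rw [snocMap_apply, snocMap_apply, snocVec_inj] at h
  rw [hT h.1, mul_left_cancel₀ hc h.2]

namespace PolyData

section Wedge

variable {d f : ℕ}

theorem mem_facet_iff {P : PolyData d f} {i : Fin f} {z : Fin d → ℝ} (hz : z ∈ P.toSet) :
    z ∈ P.facet i ↔ P.slack i z = 0 := by
  rw [slack_apply, sub_eq_zero]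
  exact ⟨And.right, fun h => ⟨hz, h⟩⟩

/-- The wedge `{(z, t) : z ∈ P, 0 ≤ t ≤ slack of the inequality i₀ at z}`. -/
def wedge (P : PolyData d f) (i₀ : Fin f) : PolyData (d + 1) (f + 1) where
  A := Fin.snoc (α := fun _ => Fin (d + 1) → ℚ)
    (fun i => Fin.snoc (α := fun _ => ℚ) (P.A i) (if i = i₀ then -1 else 0))
    (Fin.snoc (α := fun _ => ℚ) (fun _ => 0) 1)
  b := Fin.snoc (α := fun _ => ℚ) P.b 0

variable {P : PolyData d f} {i₀ : Fin f}

theorem slack_wedge_castSucc (i : Fin f) (z : Fin d → ℝ) (t : ℝ) :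
    (P.wedge i₀).slack i.castSucc (snocVec z t) = P.slack i z - if i = i₀ then t else 0 := by
  rw [slack_apply, eval, sum_mul_snocVec, slack_apply, eval]
  simp only [row, rhs, wedge, Fin.snoc_castSucc, Fin.snoc_last]
  split_ifs <;> push_cast <;> ring

theorem slack_wedge_last (z : Fin d → ℝ) (t : ℝ) :
    (P.wedge i₀).slack (Fin.last f) (snocVec z t) = t := by
  rw [slack_apply, eval, sum_mul_snocVec]
  simp [row, rhs, wedge]

theorem mem_wedge_iff {z : Fin d → ℝ} {t : ℝ} :
    snocVec z t ∈ (P.wedge i₀).toSet ↔ z ∈ P.toSet ∧ 0 ≤ t ∧ t ≤ P.slack i₀ z := by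
  simp only [mem_toSet_iff, Fin.forall_fin_succ', slack_wedge_castSucc, slack_wedge_last]
  constructor
  · rintro ⟨h, ht⟩
    have h0 := h i₀
    rw [if_pos rfl] at h0
    refine ⟨fun i => ?_, ht, by linarith⟩
    have := h i
    split_ifs at this <;> linarith
  · rintro ⟨h, ht, h0⟩
    refine ⟨fun i => ?_, ht⟩
    have := h i
    split_ifs with hi
    · subst hi; linarith
    · linarith

theorem IsProper.wedge (hP : P.IsProper) (i₀ : Fin f) : (P.wedge i₀).IsProper := by
  obtain ⟨x₀, hx₀⟩ := hP.exists_slack_pos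
  refine isProper_of_slack ⟨snocVec x₀ (P.slack i₀ x₀ / 2), fun i => ?_⟩ fun i => ?_
  · have h0 := hx₀ i₀
    refine Fin.lastCases ?_ (fun i => ?_) i
    · rw [slack_wedge_last]; linarith
    · rw [slack_wedge_castSucc]
      split_ifs with h
      · subst h; linarith
      · simpa using hx₀ i
  · refine Fin.lastCases ?_ (fun i => ?_) i
    · refine ⟨snocVec x₀ 0, slack_wedge_last _ _, fun j => ?_⟩
      refine Fin.lastCases (fun h => absurd rfl h) (fun j _ => ?_) j
      simpa [slack_wedge_castSucc] using hx₀ j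
    · rcases eq_or_ne i i₀ with rfl | hi
      · refine ⟨snocVec x₀ (P.slack i x₀), by simp [slack_wedge_castSucc], fun j => ?_⟩
        refine Fin.lastCases (fun _ => ?_) (fun j hj => ?_) j
        · simpa [slack_wedge_last] using hx₀ i
        · have : j ≠ i := fun h => hj (by rw [h])
          simpa [slack_wedge_castSucc, this] using hx₀ j
      · obtain ⟨y, hy, hy'⟩ := hP.exists_facet_point i
        have h0 := hy' i₀ hi.symm
        refine ⟨snocVec y (P.slack i₀ y / 2), by simp [slack_wedge_castSucc, hy, hi],
          fun j => ?_⟩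
        refine Fin.lastCases (fun _ => ?_) (fun j hj => ?_) j
        · rw [slack_wedge_last]; linarith
        · have hji : j ≠ i := fun h => hj (by rw [h])
          rw [slack_wedge_castSucc]
          split_ifs with h
          · subst h; linarith
          · simpa using hy' j hji

theorem wedge_isWedgeOver (hP : P.IsProper) (i₀ : Fin f) : (P.wedge i₀).IsWedgeOver P i₀ := by
  have hsum : ∀ z t, ∑ j, (snocVec (fun j => -P.row i₀ j) 1 : Fin (d + 1) → ℝ) j * snocVec z t j =
      t - P.slack i₀ z - P.rhs i₀ := fun z t => by
    rw [sum_mul_snocVec, slack_apply, eval]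
    simp
    ring
  refine ⟨snocVec (fun j => -P.row i₀ j) 1, -P.rhs i₀, fun z hz => ?_, ?_, fun z hz => ?_, ?_⟩
  · rw [hsum]
    have := P.mem_toSet_iff.1 hz i₀
    linarith
  · obtain ⟨x₀, hx₀⟩ := hP.exists_slack_pos
    refine ⟨x₀, fun i => sub_pos.1 (hx₀ i), P.slack i₀ x₀, hx₀ i₀, ?_⟩
    rw [hsum]
    ring
  · rw [hsum, mem_facet_iff hz]
    constructor <;> intro h <;> linarith
  · ext w
    obtain ⟨z, t, rfl⟩ := exists_eq_snocVec w
    rw [mem_wedge_iff]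
    simp only [Set.mem_inter_iff, Set.mem_ofPred_eq, hsum, snocVec_inj]
    constructor
    · rintro ⟨hz, ht, h⟩
      exact ⟨by linarith, z, hz, t, ht, rfl, rfl⟩
    · rintro ⟨h, z, hz, t, ht, rfl, rfl⟩
      exact ⟨hz, ht, by linarith⟩

/-- Every wedge over a facet is the standard one up to scaling of the last coordinate. -/
theorem IsWedgeOver.exists_mem_iff {W : PolyData (d + 1) (f + 1)} (hP : P.IsProper)
    (hW : W.IsWedgeOver P i₀) : ∃ ε > 0, ∀ z t, snocVec z t ∈ W.toSet ↔
      z ∈ P.toSet ∧ 0 ≤ t ∧ ε * t ≤ P.slack i₀ z := by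
  obtain ⟨a, β, h1, ⟨x₀, hx₀, t₀, ht₀, h2⟩, h3, h4⟩ := hW
  simp only [sum_mul_snocVec, mul_zero, add_zero] at h1 h2 h3
  let h : (Fin d → ℝ) →ᵃ[ℝ] ℝ := AffineMap.const ℝ (Fin d → ℝ) β -
    (∑ j : Fin d, a j.castSucc • LinearMap.proj (R := ℝ) (φ := fun _ : Fin d => ℝ) j).toAffineMap
  have hh : ∀ z, h z = β - ∑ j : Fin d, a j.castSucc * z j := fun z => by simp [h]
  have hx₀' : ∀ i, 0 < P.slack i x₀ := fun i => sub_pos.2 (hx₀ i)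
  have hx₀P : x₀ ∈ P.toSet := P.mem_toSet_iff.2 fun i => (hx₀' i).le
  have hnn : ∀ z ∈ P.toSet, 0 ≤ h z := fun z hz => by rw [hh]; linarith [h1 z hz]
  have hpos : 0 < h x₀ := (hnn x₀ hx₀P).lt_of_ne' fun h0 => by
    rw [hh] at h0
    have := (h3 x₀ hx₀P).1 (by linarith)
    exact (hx₀' i₀).ne' ((mem_facet_iff hx₀P).1 this)
  have hal : 0 < a (Fin.last d) := by
    rw [hh] at hpos
    by_contra! hle
    nlinarith
  obtain ⟨y, hy, hy'⟩ := hP.exists_facet_point i₀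
  have hyP : y ∈ P.toSet := P.mem_toSet_iff.2 fun i => by
    rcases eq_or_ne i i₀ with rfl | hne
    · exact hy.ge
    · exact (hy' i hne).le
  have hy0 : h y = 0 := by
    rw [hh, (h3 y hyP).2 ((mem_facet_iff hyP).2 hy), sub_self]
  have hprop := mul_slack_eq_of_nonneg hnn hy hy' hy0 (hx₀' i₀)
  have hκ := div_pos hpos (hx₀' i₀)
  set κ := h x₀ / P.slack i₀ x₀
  refine ⟨a (Fin.last d) / κ, div_pos hal hκ, fun z t => ?_⟩
  have hiff : ∑ j : Fin d, a j.castSucc * z j + a (Fin.last d) * t ≤ β ↔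
      a (Fin.last d) / κ * t ≤ P.slack i₀ z := by
    rw [div_mul_eq_mul_div, div_le_iff₀ hκ, mul_comm _ κ, ← hprop, hh]
    constructor <;> intro <;> linarith
  rw [h4]
  simp only [Set.mem_inter_iff, Set.mem_ofPred_eq, sum_mul_snocVec, snocVec_inj, hiff]
  constructor
  · rintro ⟨hle, z, hz, t, ht, rfl, rfl⟩
    exact ⟨hz, ht, hle⟩
  · rintro ⟨hz, ht, hle⟩
    exact ⟨hle, z, hz, t, ht, rfl, rfl⟩

/-- A wedge on a face of `P` is a face of a wedge on `P`. -/
theorem isExtreme_image_wedge {d' f' : ℕ} {Q : PolyData d' f'}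
    {T : (Fin d' → ℝ) →ᵃ[ℝ] (Fin d → ℝ)} (hE : IsExtreme ℝ P.toSet (T '' Q.toSet))
    {j : Fin f'} {ε μ : ℝ} (hε : 0 < ε) (hμ : 0 < μ)
    {W : PolyData (d + 1) (f + 1)}
    (hW : ∀ z t, snocVec z t ∈ W.toSet ↔ z ∈ P.toSet ∧ 0 ≤ t ∧ ε * t ≤ P.slack i₀ z)
    (hs : ∀ x, P.slack i₀ (T x) = μ * Q.slack j x) :
    IsExtreme ℝ W.toSet (T.snocMap (μ / ε) '' (Q.wedge j).toSet) := by
  have hc : 0 < μ / ε := div_pos hμ hε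
  have hscale : ∀ s, ε * (μ / ε * s) = μ * s := fun s => by field_simp
  constructor
  · rintro _ ⟨w, hw, rfl⟩
    obtain ⟨x, s, rfl⟩ := exists_eq_snocVec w
    rw [mem_wedge_iff] at hw
    rw [AffineMap.snocMap_apply, hW, hs, hscale]
    exact ⟨hE.subset ⟨x, hw.1, rfl⟩, mul_nonneg hc.le hw.2.1,
      mul_le_mul_of_nonneg_left hw.2.2 hμ.le⟩
  · rintro w₁ hw₁ w₂ hw₂ _ ⟨w, hw, rfl⟩ ⟨p, q, hp, hq, hpq, heq⟩
    obtain ⟨x, s, rfl⟩ := exists_eq_snocVec w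
    obtain ⟨z₁, t₁, rfl⟩ := exists_eq_snocVec w₁
    obtain ⟨z₂, t₂, rfl⟩ := exists_eq_snocVec w₂
    rw [mem_wedge_iff] at hw
    rw [hW] at hw₁ hw₂
    rw [AffineMap.snocMap_apply] at heq
    have hseg : T x ∈ openSegment ℝ z₁ z₂ := by
      refine ⟨p, q, hp, hq, hpq, ?_⟩
      ext k
      simpa using congrFun heq k.castSucc
    obtain ⟨x₁, hx₁, rfl⟩ :=
      hE.left_mem_of_mem_openSegment hw₁.1 hw₂.1 ⟨x, hw.1, rfl⟩ hseg
    have ht₁ : t₁ = μ / ε * (t₁ / (μ / ε)) := by field_simp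
    refine ⟨snocVec x₁ (t₁ / (μ / ε)), mem_wedge_iff.2 ⟨hx₁, div_nonneg hw₁.2.1 hc.le, ?_⟩, ?_⟩
    · have h := hw₁.2.2
      rw [hs, ht₁, hscale] at h
      exact le_of_mul_le_mul_left h hμ
    · rw [AffineMap.snocMap_apply, ← ht₁]

end Wedge

theorem isExtreme_setOf_subset_activeAt {d f : ℕ} (P : PolyData d f) (S : Set (Fin f)) :
    IsExtreme ℝ P.toSet {z ∈ P.toSet | S ⊆ P.activeAt z} := by
  refine ⟨fun z hz => hz.1, ?_⟩
  rintro x hx y hy z ⟨-, hz⟩ ⟨p, q, hp, hq, hpq, rfl⟩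
  refine ⟨hx, fun i hi => P.mem_activeAt_iff.2 ?_⟩
  have h := P.mem_activeAt_iff.1 (hz hi)
  have hx := P.mem_toSet_iff.1 hx i
  have hy := P.mem_toSet_iff.1 hy i
  have hcomb : P.slack i (p • x + q • y) = p * P.slack i x + q * P.slack i y := by
    have : P.eval i (p • x + q • y) = p * P.eval i x + q * P.eval i y := by
      simpa using (P.evalLin i).map_add (p • x) (q • y)
    simp only [slack_apply, this]
    linear_combination P.rhs i * hpq
  rw [hcomb] at h
  nlinarith [mul_nonneg hq.le hy]

/-- `C`-simplicity passes from a polyhedron to its faces. -/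
theorem IsCSimple.of_isExtreme {d f d' f' : ℕ} {P : PolyData d f} {Q : PolyData d' f'}
    {T : (Fin d' → ℝ) →ᵃ[ℝ] (Fin d → ℝ)} (hP : P.IsCSimple) (hQ : Q.IsProper)
    (hd : 2 ≤ d) (hT : Function.Injective T) (hE : IsExtreme ℝ P.toSet (T '' Q.toSet)) :
    Q.IsCSimple := by
  intro k hk y hy
  rcases Nat.eq_zero_or_pos k with rfl | hk0
  · exact fun i => i.elim0
  have hlt := lt_of_one_le_maxEdgeDiameter (le_trans (by exact_mod_cast hk0) hk)
  have hcard := card_facets_add_le hQ hT hE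
  exact ((hP.isStepSimple (one_le_maxEdgeDiameter hd (by omega))).of_isExtreme hQ hT
    hE).isSimpleWalk hy

end PolyData

/-- Lemma 10: any `d'`-dimensional face `F` of a
wedge-simple `d`-dimensional polyhedron `P`, with `1 < d' < d`, is itself
wedge-simple (as a polyhedron, i.e. in any proper realization of `F` as a
full-dimensional polyhedron in `ℝ^{d'}`). -/
theorem face_of_wedgeSimple_is_wedgeSimple {d f d' f' : ℕ}
    (P : PolyData d f) (hP : P.IsProper) (hws : P.IsWedgeSimple)
    (S : Set (Fin f)) (F : Set (Fin d → ℝ))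
    (hF : F = {z ∈ P.toSet | S ⊆ P.activeAt z})
    (hd1 : 1 < d') (hd2 : d' < d)
    (hdim : Module.finrank ℝ (affineSpan ℝ F).direction = d')
    (Q : PolyData d' f') (hQ : Q.IsProper)
    (T : (Fin d' → ℝ) →ᵃ[ℝ] (Fin d → ℝ)) (hT : Function.Injective T)
    (hTQ : T '' Q.toSet = F) :
    Q.IsWedgeSimple := by
  subst hF
  have hE : IsExtreme ℝ P.toSet (T '' Q.toSet) := hTQ ▸ P.isExtreme_setOf_subset_activeAt S
  refine ⟨hws.1.of_isExtreme hQ (by omega) hT hE, fun j => ?_⟩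
  obtain ⟨x₀, hx₀⟩ := hQ.exists_slack_pos
  obtain ⟨i, μ, hμ, hs⟩ := PolyData.exists_slack_map_eq hQ hT hE hx₀ j
  obtain ⟨W, -, hWP, hWC⟩ := hws.2 i
  obtain ⟨ε, hε, hW⟩ := hWP.exists_mem_iff hP
  exact ⟨Q.wedge j, hQ.wedge j, PolyData.wedge_isWedgeOver hQ j,
    hWC.of_isExtreme (hQ.wedge j) (by omega) (AffineMap.snocMap_injective hT (div_pos hμ hε).ne')
      (PolyData.isExtreme_image_wedge hE hε hμ hW hs)⟩
end

section
/- Assume that for every polyhedron and any two of its vertices there is a non-revisiting circuit walk between them (the non-revisiting conjecture). Then for every d-dimensional polyhedron P with f facets, every feasible point u ∈ P incident to d' linearly independent facets of P, and every vertex v of P, there is a circuit walk from u to v that enters a new facet in each step (and hence has length at most f − d'). -/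
open scoped BigOperators

namespace PolyData

variable {d f : ℕ}

lemma eval_add_smul (P : PolyData d f) (i : Fin f) (u g : Fin d → ℝ) (c : ℝ) :
    P.eval i (u + c • g) = P.eval i u + c * P.eval i g := by
  simp only [eval, Pi.add_apply, Pi.smul_apply, smul_eq_mul, mul_add, Finset.sum_add_distrib,
    Finset.mul_sum]
  congr 1
  exact Finset.sum_congr rfl fun j _ => by ring

lemma eval_neg (P : PolyData d f) (i : Fin f) (g : Fin d → ℝ) :
    P.eval i (-g) = -P.eval i g := by
  simp [eval]

/-- A vector orthogonal to a spanning family of rows vanishes. -/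
lemma eq_zero_of_span_eq_top (P : PolyData d f) {S : Set (Fin f)}
    (hS : Submodule.span ℝ (P.row '' S) = ⊤) {x : Fin d → ℝ} (hx : ∀ i ∈ S, P.eval i x = 0) :
    x = 0 := by
  have hle : Submodule.span ℝ (P.row '' S) ≤ LinearMap.ker (∑ j, x j • LinearMap.proj (R := ℝ)
      (φ := fun _ : Fin d => ℝ) j) := by
    rw [Submodule.span_le]
    rintro _ ⟨i, hi, rfl⟩
    simpa [eval, mul_comm] using hx i hi
  have hxx : x ∈ Submodule.span ℝ (P.row '' S) := hS ▸ Submodule.mem_top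
  have h0 : x ⬝ᵥ x = 0 := by
    simpa [dotProduct] using hle hxx
  exact dotProduct_self_eq_zero.mp h0

/-- If a family of rows does not span, some nonzero vector is orthogonal to all of them. -/
lemma exists_ne_zero_of_span_ne_top (P : PolyData d f) {S : Set (Fin f)}
    (hS : Submodule.span ℝ (P.row '' S) ≠ ⊤) :
    ∃ x : Fin d → ℝ, x ≠ 0 ∧ ∀ i ∈ S, P.eval i x = 0 := by
  obtain ⟨φ, hφ, hle⟩ := Submodule.exists_le_ker_of_lt_top _ (lt_top_iff_ne_top.mpr hS)
  have key : ∀ w : Fin d → ℝ, φ w = ∑ j, w j * φ (Pi.single j 1) := fun w => by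
    conv_lhs => rw [LinearMap.pi_apply_eq_sum_univ φ w]
    simp only [smul_eq_mul]
    refine Finset.sum_congr rfl fun j _ => ?_
    congr 2
    ext k
    simp [Pi.single_apply, eq_comm]
  refine ⟨fun j => φ (Pi.single j 1), fun h => hφ ?_, fun i hi => ?_⟩
  · ext w
    simp [congrFun h]
  · have h := hle (Submodule.subset_span ⟨i, hi, rfl⟩)
    rw [LinearMap.mem_ker, key] at h
    exact h

/-- A nonzero vector orthogonal to a family of rows can be replaced by a circuit. -/
lemma exists_circuit (P : PolyData d f) {S : Set (Fin f)} {x : Fin d → ℝ} (hx : x ≠ 0)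
    (hxS : ∀ i ∈ S, P.eval i x = 0) : ∃ g, P.IsCircuit g ∧ ∀ i ∈ S, P.eval i g = 0 := by
  let C : Set (Set (Fin f)) := {s | ∃ g : Fin d → ℝ, g ≠ 0 ∧ (∀ i ∈ S, P.eval i g = 0) ∧
    s = {i | P.eval i g ≠ 0}}
  obtain ⟨s, ⟨g, hg, hgS, rfl⟩, hmin⟩ :=
    C.toFinite.exists_minimal ⟨_, x, hx, hxS, rfl⟩
  refine ⟨g, ⟨hg, fun z hz hsub => ?_⟩, hgS⟩
  refine hsub.antisymm (hmin ⟨z, hz, fun i hi => ?_, rfl⟩ hsub)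
  by_contra hne
  exact hsub hne (hgS i hi)

lemma IsCircuit.neg {P : PolyData d f} {g : Fin d → ℝ} (hg : P.IsCircuit g) :
    P.IsCircuit (-g) := by
  simpa [IsCircuit, eval_neg] using hg

/-- From a feasible point along a direction that keeps the active constraints tight and decreases
some constraint there is a maximal step, and it gains an active constraint. -/
lemma exists_maximal_step (P : PolyData d f) {u g : Fin d → ℝ} (hu : u ∈ P.toSet)
    (hact : ∀ i ∈ P.activeAt u, P.eval i g = 0) (hneg : ∃ i, P.eval i g < 0) :
    ∃ α : ℝ, 0 < α ∧ u + α • g ∈ P.toSet ∧ (∀ β, α < β → u + β • g ∉ P.toSet) ∧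
      P.activeAt u ⊂ P.activeAt (u + α • g) := by
  classical
  obtain ⟨i, hi, hmin⟩ := (Finset.univ.filter fun i => P.eval i g < 0).exists_min_image
    (fun i => (P.eval i u - P.rhs i) / (-P.eval i g)) (by simpa [Finset.Nonempty] using hneg)
  replace hi : P.eval i g < 0 := by simpa using hi
  have hi' : i ∉ P.activeAt u := fun h => hi.ne (hact i h)
  have hlt : P.rhs i < P.eval i u := lt_of_le_of_ne (hu i) fun h => hi' h.symm
  set α := (P.eval i u - P.rhs i) / (-P.eval i g) with hα
  have hαpos : 0 < α := div_pos (by linarith) (by linarith)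
  have hαi : P.eval i u + α * P.eval i g = P.rhs i := by
    rw [hα]
    field_simp [hi.ne]
    ring
  refine ⟨α, hαpos, fun k => ?_, fun β hβ hmem => ?_, fun k hk => ?_, fun hsub => hi' (hsub ?_)⟩
  · rw [eval_add_smul]
    rcases lt_or_ge (P.eval k g) 0 with hk | hk
    · have h := hmin k (by simpa using hk)
      rw [le_div_iff₀ (by linarith)] at h
      linarith
    · have := hu k
      have := mul_nonneg hαpos.le hk
      linarith
  · have h := hmem i
    rw [eval_add_smul] at h
    have := mul_lt_mul_of_neg_right hβ hi
    linarith
  · change P.eval k (u + α • g) = P.rhs k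
    rw [eval_add_smul, hact k hk, mul_zero, add_zero]
    exact hk
  · change P.eval i (u + α • g) = P.rhs i
    rw [eval_add_smul, hαi]

/-- In a pointed polyhedron, from any feasible point that is not a vertex there is a maximal circuit
step inside its minimal face. -/
lemma exists_circuit_step (P : PolyData d f) {u v : Fin d → ℝ} (hu : u ∈ P.toSet)
    (hv : P.IsVertex v) (hnv : ¬ P.IsVertex u) :
    ∃ g ∈ P.circuits, ∃ α : ℝ, 0 < α ∧ u + α • g ∈ P.toSet ∧
      (∀ β, α < β → u + β • g ∉ P.toSet) ∧ P.activeAt u ⊂ P.activeAt (u + α • g) := by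
  obtain ⟨x, hx, hxS⟩ := P.exists_ne_zero_of_span_ne_top fun h => hnv ⟨hu, h⟩
  obtain ⟨g, hg, hgS⟩ := P.exists_circuit hx hxS
  obtain ⟨i, hi⟩ : ∃ i, P.eval i g ≠ 0 := by
    by_contra! h
    exact hg.1 (P.eq_zero_of_span_eq_top hv.2 fun i _ => h i)
  rcases lt_or_gt_of_ne hi with hi | hi
  · exact ⟨g, hg, P.exists_maximal_step hu hgS ⟨i, hi⟩⟩
  · exact ⟨-g, hg.neg, P.exists_maximal_step hu (fun k hk => by rw [eval_neg, hgS k hk, neg_zero])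
      ⟨i, by rw [eval_neg]; linarith⟩⟩

lemma IsCircuitWalk.cons {P : PolyData d f} {m : ℕ} {y : Fin (m + 1) → Fin d → ℝ}
    (hy : P.IsCircuitWalk y) {u g : Fin d → ℝ} (hu : u ∈ P.toSet) (hg : g ∈ P.circuits) {α : ℝ}
    (hα : 0 < α) (h0 : y 0 = u + α • g) (hmax : ∀ β, α < β → u + β • g ∉ P.toSet) :
    P.IsCircuitWalk (Fin.cons u y : Fin (m + 1 + 1) → Fin d → ℝ) := by
  refine ⟨fun i => ?_, fun i => ?_⟩
  · cases i using Fin.cases with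
    | zero => exact hu
    | succ i => exact hy.1 i
  · cases i using Fin.cases with
    | zero => exact ⟨g, hg, α, hα, h0, hmax⟩
    | succ i => exact hy.2 i

/-- Prepending a step that gains an active constraint and loses none keeps a walk
non-revisiting. -/
lemma IsNonRevisiting.cons {P : PolyData d f} {m : ℕ} {y : Fin (m + 1) → Fin d → ℝ}
    (hy : P.IsNonRevisiting y) {u : Fin d → ℝ} (hact : P.activeAt u ⊂ P.activeAt (y 0)) :
    P.IsNonRevisiting (Fin.cons u y : Fin (m + 1 + 1) → Fin d → ℝ) := by
  intro i
  cases i using Fin.cases with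
  | zero =>
    obtain ⟨j, hj, hju⟩ := Set.exists_of_ssubset hact
    refine ⟨j, hj, fun i' hi' => ?_⟩
    obtain rfl : i' = 0 := Fin.le_zero_iff.mp hi'
    exact hju
  | succ i =>
    obtain ⟨j, hj, hjn⟩ := hy i
    refine ⟨j, hj, fun i' hi' => ?_⟩
    cases i' using Fin.cases with
    | zero => exact fun h => hjn 0 (Fin.zero_le _) (hact.1 h)
    | succ i' => exact hjn i' (Fin.succ_le_succ_iff.mp hi')

/-- A non-revisiting walk has at most as many steps as there are constraints inactive at its
start. -/
lemma IsNonRevisiting.length_le {P : PolyData d f} {m : ℕ} {y : Fin (m + 1) → Fin d → ℝ}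
    (hy : P.IsNonRevisiting y) {T : Finset (Fin f)} (hT : ↑T ⊆ P.activeAt (y 0)) :
    m ≤ f - T.card := by
  choose j hj hjn using hy
  have hlt : ∀ a b : Fin m, a < b → j a ≠ j b := fun a b hab h =>
    hjn b a.succ (Fin.succ_le_castSucc_iff.mpr hab) (h ▸ hj a)
  have hinj : Function.Injective j := fun a b h => by
    rcases lt_trichotomy a b with hab | hab | hab
    · exact absurd h (hlt a b hab)
    · exact hab
    · exact absurd h.symm (hlt b a hab)
  calc m = (Finset.univ.image j).card := by simp [Finset.card_image_of_injective _ hinj]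
    _ ≤ Tᶜ.card := Finset.card_le_card fun k hk => by
        obtain ⟨a, -, rfl⟩ := Finset.mem_image.mp hk
        exact Finset.mem_compl.mpr fun h => hjn a 0 (Fin.zero_le _) (hT h)
    _ = f - T.card := by simp [Finset.card_compl]

/-- If non-revisiting circuit walks to `v` exist from all vertices of `P`, they exist from all
feasible points. -/
lemma exists_nonRevisiting_walk (P : PolyData d f) {v : Fin d → ℝ} (hv : P.IsVertex v)
    (hNR : ∀ u : Fin d → ℝ, P.IsVertex u → ∃ (m : ℕ) (y : Fin (m + 1) → Fin d → ℝ),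
      P.IsCircuitWalk y ∧ P.IsNonRevisiting y ∧ y 0 = u ∧ y (Fin.last m) = v)
    (u : Fin d → ℝ) (hu : u ∈ P.toSet) : ∃ (m : ℕ) (y : Fin (m + 1) → Fin d → ℝ),
      P.IsCircuitWalk y ∧ P.IsNonRevisiting y ∧ y 0 = u ∧ y (Fin.last m) = v := by
  induction hS : P.activeAt u using WellFoundedGT.induction generalizing u with
  | ind S ih =>
    subst hS
    by_cases hvu : P.IsVertex u
    · exact hNR u hvu
    obtain ⟨g, hg, α, hα, hmem, hmax, hact⟩ := P.exists_circuit_step hu hv hvu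
    obtain ⟨m, y, hw, hn, h0, hlast⟩ := ih _ hact _ hmem rfl
    exact ⟨m + 1, Fin.cons u y, hw.cons hu hg hα h0 hmax, hn.cons (h0 ▸ hact), rfl, hlast⟩

end PolyData

/-- Lemma 12, "any start": assuming the non-revisiting
conjecture, from any feasible point `u` incident to `d'` linearly independent
facets there is a circuit walk to any vertex `v` entering a new facet in each
step, hence of length at most `f - d'`. -/
theorem any_start_nonrevisiting
    (hNR : ∀ (d f : ℕ) (P : PolyData d f), P.IsProper →
      ∀ u v : Fin d → ℝ, P.IsVertex u → P.IsVertex v →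
        ∃ (m : ℕ) (y : Fin (m+1) → Fin d → ℝ), P.IsCircuitWalk y ∧
          P.IsNonRevisiting y ∧ y 0 = u ∧ y (Fin.last m) = v)
    {d f : ℕ} (P : PolyData d f) (hP : P.IsProper)
    (u : Fin d → ℝ) (hu : u ∈ P.toSet) (d' : ℕ) (T : Finset (Fin f))
    (hTactive : ↑T ⊆ P.activeAt u) (hTcard : T.card = d')
    (hTindep : LinearIndependent ℝ (fun i : {i // i ∈ T} => P.row i.1))
    (v : Fin d → ℝ) (hv : P.IsVertex v) :
    ∃ (m : ℕ) (y : Fin (m+1) → Fin d → ℝ), P.IsCircuitWalk y ∧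
      P.IsNonRevisiting y ∧ y 0 = u ∧ y (Fin.last m) = v ∧ m ≤ f - d' := by
  obtain ⟨m, y, hw, hn, h0, hlast⟩ :=
    P.exists_nonRevisiting_walk hv (fun w hw => hNR d f P hP w v hw hv) u hu
  exact ⟨m, y, hw, hn, h0, hlast, hTcard ▸ hn.length_le (h0 ▸ hTactive)⟩
end

section
/- Let P be a d-dimensional unbounded polyhedron with f facets, and let u, v be two vertices of P that do not share a facet. Then there is a bounded polyhedron P' ⊆ P obtained from P by adding at most d − 1 inequality constraints, each of which defines a facet incident to u whose outer normal is the negative of the outer normal of a facet of P incident to v. In this construction u and v are vertices of P' and the circuit sets satisfy C(P) = C(P'). -/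
open scoped BigOperators

namespace PolyData

open Matrix

variable {d f : ℕ} (P : PolyData d f)

theorem eval_eq_dotProduct (i : Fin f) (z : Fin d → ℝ) : P.eval i z = P.row i ⬝ᵥ z := rfl

/-- Every vertex is determined by `d` active constraints with invertible coefficient matrix. -/
theorem IsVertex.exists_active_basis {P : PolyData d f} {v : Fin d → ℝ} (hv : P.IsVertex v) :
    ∃ e : Fin d → Fin f, (∀ j, e j ∈ P.activeAt v) ∧ (P.A.submatrix e id).det ≠ 0 := by
  obtain ⟨g, hg, -, hli⟩ :=
    Submodule.exists_fun_fin_finrank_span_eq ℝ (P.row '' P.activeAt v)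
  have hd : Module.finrank ℝ (Submodule.span ℝ (P.row '' P.activeAt v)) = d := by
    rw [hv.2, finrank_top, Module.finrank_fin_fun]
  choose e he heg using hg
  refine ⟨fun j => e (finCongr hd.symm j), fun j => he _, fun hdet => ?_⟩
  have hli' : LinearIndependent ℝ
      ((P.A.submatrix (fun j => e (finCongr hd.symm j)) id).map (algebraMap ℚ ℝ)).row := by
    have h := hli.comp _ (finCongr hd.symm).injective
    rw [← funext heg] at h
    exact h
  rw [Matrix.linearIndependent_rows_iff_isUnit, Matrix.isUnit_iff_isUnit_det,
    ← RingHom.mapMatrix_apply, ← RingHom.map_det, hdet, map_zero] at hli'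
  exact not_isUnit_zero hli'

/-- Vertices of a polyhedron given by rational data are rational. -/
theorem IsVertex.exists_rat {P : PolyData d f} {u : Fin d → ℝ} (hu : P.IsVertex u) :
    ∃ q : Fin d → ℚ, ∀ j, (q j : ℝ) = u j := by
  obtain ⟨e, he, hdet⟩ := hu.exists_active_basis
  set M := P.A.submatrix e id
  have hunit : IsUnit M.det := isUnit_iff_ne_zero.mpr hdet
  refine ⟨M⁻¹ *ᵥ (P.b ∘ e), fun j => ?_⟩
  have hb : (algebraMap ℚ ℝ) ∘ (P.b ∘ e) = M.map (algebraMap ℚ ℝ) *ᵥ u := by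
    funext i
    exact (he i).symm
  have h1 : M⁻¹.map (algebraMap ℚ ℝ) * M.map (algebraMap ℚ ℝ) = 1 := by
    rw [← Matrix.map_mul, Matrix.nonsing_inv_mul M hunit,
      Matrix.map_one _ (map_zero _) (map_one _)]
  have h2 := RingHom.map_mulVec (algebraMap ℚ ℝ) M⁻¹ (P.b ∘ e) j
  rw [hb, Matrix.mulVec_mulVec, h1, Matrix.one_mulVec] at h2
  exact h2

/-- Coordinates with respect to `d` linearly independent constraints: the points of `ℝ^d` are
recovered affinely from their values on these constraints. -/
theorem exists_coordinates {e : Fin d → Fin f} (hdet : (P.A.submatrix e id).det ≠ 0) :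
    ∃ N : Matrix (Fin d) (Fin d) ℝ, ∀ z v : Fin d → ℝ,
      z = v + N *ᵥ fun i => P.eval (e i) z - P.eval (e i) v := by
  set M := P.A.submatrix e id
  have hunit : IsUnit M.det := isUnit_iff_ne_zero.mpr hdet
  refine ⟨M⁻¹.map (algebraMap ℚ ℝ), fun z v => ?_⟩
  have h1 : M⁻¹.map (algebraMap ℚ ℝ) * M.map (algebraMap ℚ ℝ) = 1 := by
    rw [← Matrix.map_mul, Matrix.nonsing_inv_mul M hunit,
      Matrix.map_one _ (map_zero _) (map_one _)]
  have h2 : (fun i => P.eval (e i) z - P.eval (e i) v) =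
      M.map (algebraMap ℚ ℝ) *ᵥ (z - v) := by
    rw [Matrix.mulVec_sub]
    rfl
  rw [h2, Matrix.mulVec_mulVec, h1, Matrix.one_mulVec, add_sub_cancel]

/-- Add to `P`, for each `j`, the constraint opposite to the `s j`-th one with the
right-hand side `c j`. -/
def addOpposite {m : ℕ} (s : Fin m → Fin f) (c : Fin m → ℚ) : PolyData d (f + m) where
  A := Matrix.of (Fin.append P.A fun j => - P.A (s j))
  b := Fin.append P.b c

section addOpposite

variable {m : ℕ} (s : Fin m → Fin f) (c : Fin m → ℚ)

theorem addOpposite_A_castAdd (i : Fin f) :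
    (P.addOpposite s c).A (Fin.castAdd m i) = P.A i :=
  Fin.append_left P.A (fun j => - P.A (s j)) i

theorem addOpposite_A_natAdd (j : Fin m) :
    (P.addOpposite s c).A (Fin.natAdd f j) = - P.A (s j) :=
  Fin.append_right P.A (fun j => - P.A (s j)) j

theorem addOpposite_b_castAdd (i : Fin f) :
    (P.addOpposite s c).b (Fin.castAdd m i) = P.b i :=
  Fin.append_left _ _ i

theorem addOpposite_b_natAdd (j : Fin m) :
    (P.addOpposite s c).b (Fin.natAdd f j) = c j :=
  Fin.append_right _ _ j

theorem addOpposite_row_castAdd (i : Fin f) :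
    (P.addOpposite s c).row (Fin.castAdd m i) = P.row i := by
  funext j
  simp only [row, addOpposite_A_castAdd]

theorem addOpposite_eval_castAdd (i : Fin f) (z : Fin d → ℝ) :
    (P.addOpposite s c).eval (Fin.castAdd m i) z = P.eval i z := by
  simp only [eval, addOpposite_row_castAdd]

theorem addOpposite_eval_natAdd (j : Fin m) (z : Fin d → ℝ) :
    (P.addOpposite s c).eval (Fin.natAdd f j) z = - P.eval (s j) z := by
  simp [eval, row, addOpposite_A_natAdd]

theorem mem_addOpposite_toSet {z : Fin d → ℝ} :
    z ∈ (P.addOpposite s c).toSet ↔ z ∈ P.toSet ∧ ∀ j, (c j : ℝ) ≤ - P.eval (s j) z := by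
  simp [toSet, Fin.forall_fin_add, rhs, addOpposite_eval_castAdd, addOpposite_eval_natAdd,
    addOpposite_b_castAdd, addOpposite_b_natAdd]

variable {P s c}

theorem IsVertex.addOpposite {v : Fin d → ℝ} (hv : P.IsVertex v)
    (h : ∀ j, (c j : ℝ) ≤ - P.eval (s j) v) : (P.addOpposite s c).IsVertex v := by
  refine ⟨(P.mem_addOpposite_toSet s c).2 ⟨hv.1, h⟩, top_unique ?_⟩
  rw [← hv.2]
  apply Submodule.span_mono
  rintro _ ⟨i, hi, rfl⟩
  refine ⟨Fin.castAdd m i, ?_, addOpposite_row_castAdd P s c i⟩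
  simpa [activeAt, rhs, addOpposite_eval_castAdd, addOpposite_b_castAdd] using hi

variable (P s c)

theorem addOpposite_support_subset_iff (x g : Fin d → ℝ) :
    {i | (P.addOpposite s c).eval i x ≠ 0} ⊆ {i | (P.addOpposite s c).eval i g ≠ 0} ↔
      {i | P.eval i x ≠ 0} ⊆ {i | P.eval i g ≠ 0} := by
  simp only [Set.subset_def, Set.mem_ofPred_eq, Fin.forall_fin_add, addOpposite_eval_castAdd,
    addOpposite_eval_natAdd, ne_eq, neg_eq_zero]
  exact ⟨fun h => h.1, fun h => ⟨h, fun j => h (s j)⟩⟩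

/-- Adding opposite constraints does not change the circuits. -/
theorem addOpposite_circuits : (P.addOpposite s c).circuits = P.circuits := by
  ext g
  simp only [circuits, IsCircuit, Set.mem_ofPred_eq, Set.Subset.antisymm_iff,
    addOpposite_support_subset_iff]

end addOpposite

/-- In the affine coordinates given by `d` independent constraints active at `v`, some coordinate
direction leaves `P`, provided another vertex shares no facet with `v`. -/
theorem exists_eval_col_neg [NeZero d] {u v : Fin d → ℝ} (hu : P.IsVertex u) (hv : v ∈ P.toSet)
    (hdisj : Disjoint (P.activeAt u) (P.activeAt v)) {e : Fin d → Fin f}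
    (he : ∀ j, e j ∈ P.activeAt v) {N : Matrix (Fin d) (Fin d) ℝ}
    (hN : ∀ z v : Fin d → ℝ, z = v + N *ᵥ fun i => P.eval (e i) z - P.eval (e i) v) :
    ∃ i₀ k, (P.row k ᵥ* N) i₀ < 0 := by
  by_contra! h
  obtain ⟨e', he', -⟩ := hu.exists_active_basis
  have hk : P.eval (e' 0) u = P.rhs (e' 0) := he' 0
  have hle : P.eval (e' 0) v ≤ P.eval (e' 0) u := by
    conv_rhs => rw [eval_eq_dotProduct, hN u v, dotProduct_add, Matrix.dotProduct_mulVec]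
    refine le_add_of_nonneg_right (Finset.sum_nonneg fun i _ => mul_nonneg (h _ _) ?_)
    have hi : P.eval (e i) v = P.rhs (e i) := he i
    exact sub_nonneg.2 (hi.le.trans (hu.1 (e i)))
  exact Set.disjoint_left.1 hdisj (he' 0) (le_antisymm (hle.trans hk.le) (hv (e' 0)))

/-- A polyhedron is bounded as soon as all but one of `d` independent constraints are bounded
above on it and the remaining coordinate direction leaves the polyhedron. -/
theorem isBounded_of_eval_le {n : ℕ} (P : PolyData (n + 1) f) {v : Fin (n + 1) → ℝ}
    {e : Fin (n + 1) → Fin f} (he : ∀ j, e j ∈ P.activeAt v)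
    {N : Matrix (Fin (n + 1)) (Fin (n + 1)) ℝ}
    (hN : ∀ z v : Fin (n + 1) → ℝ, z = v + N *ᵥ fun i => P.eval (e i) z - P.eval (e i) v)
    {i₀ : Fin (n + 1)} {k : Fin f} (hk : (P.row k ᵥ* N) i₀ < 0) (B : Fin n → ℝ) :
    Bornology.IsBounded {z ∈ P.toSet | ∀ j, P.eval (e (i₀.succAbove j)) z ≤ B j} := by
  set w := P.row k ᵥ* N with hw
  let h (j : Fin n) : ℝ := B j - P.rhs (e (i₀.succAbove j))
  let K : ℝ := (P.eval k v - P.rhs k + ∑ j, |w (i₀.succAbove j)| * h j) / (- w i₀)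
  have hcomp : IsCompact ((fun y => v + N *ᵥ y) '' Set.Icc 0 (i₀.insertNth K h)) :=
    isCompact_Icc.image (by fun_prop)
  refine hcomp.isBounded.subset fun z hz => ⟨_, ?_, (hN z v).symm⟩
  have hy : ∀ i, 0 ≤ P.eval (e i) z - P.eval (e i) v := fun i => by
    have hi : P.eval (e i) v = P.rhs (e i) := he i
    rw [hi]
    exact sub_nonneg.2 (hz.1 (e i))
  have hyB : ∀ j, P.eval (e (i₀.succAbove j)) z - P.eval (e (i₀.succAbove j)) v ≤ h j := fun j => by
    have hi : P.eval (e (i₀.succAbove j)) v = P.rhs (e (i₀.succAbove j)) := he _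
    rw [hi]
    exact sub_le_sub_right (hz.2 j) _
  refine ⟨hy, fun i => ?_⟩
  obtain rfl | ⟨j, rfl⟩ := Fin.eq_self_or_eq_succAbove i₀ i
  · rw [Fin.insertNth_apply_same, le_div_iff₀ (neg_pos.2 hk)]
    have hkz : P.rhs k ≤ P.eval k z := hz.1 k
    rw [eval_eq_dotProduct, hN z v, dotProduct_add, Matrix.dotProduct_mulVec, ← hw,
      ← eval_eq_dotProduct, dotProduct, Fin.sum_univ_succAbove _ i] at hkz
    have hsum : ∑ j, w (i.succAbove j) *
        (P.eval (e (i.succAbove j)) z - P.eval (e (i.succAbove j)) v) ≤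
        ∑ j, |w (i.succAbove j)| * h j :=
      Finset.sum_le_sum fun j _ => mul_le_mul (le_abs_self _) (hyB j) (hy _) (abs_nonneg _)
    linarith
  · rw [Fin.insertNth_apply_succAbove]
    exact hyB j

end PolyData

/-- Lemma 13: an unbounded polyhedron `P` with vertices
`u, v` sharing no facet can be made bounded by adding at most `d-1`
constraints, each defining a facet incident to `u` whose outer normal is the
negative of the outer normal of a facet of `P` incident to `v`; the vertices
`u, v` remain vertices and the circuits are unchanged. -/
theorem make_bounded_opposite_facets {d f : ℕ} (P : PolyData d f)
    (hP : P.IsProper) (hub : ¬ Bornology.IsBounded P.toSet)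
    (u v : Fin d → ℝ) (hu : P.IsVertex u) (hv : P.IsVertex v)
    (hdisj : Disjoint (P.activeAt u) (P.activeAt v)) :
    ∃ (m : ℕ), m ≤ d - 1 ∧ ∃ P' : PolyData d (f + m),
      (∀ i : Fin f, P'.A (Fin.castAdd m i) = P.A i ∧
        P'.b (Fin.castAdd m i) = P.b i) ∧
      (∀ j : Fin m, ∃ i : Fin f, i ∈ P.activeAt v ∧
        P'.A (Fin.natAdd f j) = - P.A i ∧ (Fin.natAdd f j) ∈ P'.activeAt u) ∧
      P'.toSet ⊆ P.toSet ∧ Bornology.IsBounded P'.toSet ∧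
      P'.IsVertex u ∧ P'.IsVertex v ∧ P'.circuits = P.circuits := by
  rcases d with _ | n
  · exact absurd Set.subsingleton_of_subsingleton.finite.isBounded hub
  obtain ⟨e, he, hdet⟩ := hv.exists_active_basis
  obtain ⟨N, hN⟩ := P.exists_coordinates hdet
  obtain ⟨i₀, k, hk⟩ := P.exists_eval_col_neg hu hv.1 hdisj he hN
  obtain ⟨q, hq⟩ := hu.exists_rat
  let s : Fin n → Fin f := fun j => e (i₀.succAbove j)
  let c : Fin n → ℚ := fun j => - ∑ l, P.A (s j) l * q l
  have hc : ∀ j, (c j : ℝ) = - P.eval (s j) u := fun j => by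
    simp [c, PolyData.eval, PolyData.row, hq]
  refine ⟨n, le_rfl, P.addOpposite s c,
    fun i => ⟨P.addOpposite_A_castAdd s c i, P.addOpposite_b_castAdd s c i⟩,
    fun j => ⟨s j, he _, P.addOpposite_A_natAdd s c j, ?_⟩,
    fun z hz => ((P.mem_addOpposite_toSet s c).1 hz).1, ?_,
    hu.addOpposite fun j => (hc j).le, hv.addOpposite fun j => ?_, P.addOpposite_circuits s c⟩
  · simp [PolyData.activeAt, PolyData.rhs, P.addOpposite_eval_natAdd, P.addOpposite_b_natAdd, hc]
  · refine (P.isBounded_of_eval_le he hN hk fun j => P.eval (s j) u).subset fun z hz => ?_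
    rw [P.mem_addOpposite_toSet] at hz
    refine ⟨hz.1, fun j => ?_⟩
    have := hz.2 j
    rw [hc] at this
    exact neg_le_neg_iff.1 this
  · rw [hc, neg_le_neg_iff]
    have hj : P.eval (s j) v = P.rhs (s j) := he _
    rw [hj]
    exact hu.1 (s j)
end
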